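/- arXiv:1203.3569 — 4 statements merged into one kernel-verified Lean document; each statement's English description precedes it below -/
import Mathlib

section
/- Let H(q,p) : ℝ^d × ℝ^d → ℝ be a C² autonomous Hamiltonian satisfying: ‖d²H‖ ≤ M everywhere; ∂²_{pp} H ≥ m·Id in the sense of quadratic forms everywhere; and (m/2)|p|² − M ≤ H(q,p) ≤ (M/2)|p|² + M everywhere, with 0 < m ≤ M. Let α be the critical value and let 𝒜 be the projected Aubry set, i.e. the set of points q such that every C¹ function w with H(x, dw(x)) ≤ α for all x satisfies H(q, dw(q)) = α. Then there exists a C^{1,1} function u₀ : ℝ^d → ℝ with H(q, du₀(q)) ≤ α for all q, and with the strict inequality H(q, du₀(q)) < α for every q not belonging to 𝒜. -/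
open scoped RealInnerProductSpace NNReal
open Set

section Domination

variable {X : Type*}

/-- `u` is dominated by the cost `c`. -/
def Dominated (c : X → X → ℝ) (u : X → ℝ) : Prop := ∀ x y, u y - u x ≤ c x y

/-- One step of the discrete Lax-Oleinik semigroup of the cost `c`. -/
noncomputable def laxOleinik (c : X → X → ℝ) (u : X → ℝ) (y : X) : ℝ := ⨅ x, u x + c x y

variable {c : X → X → ℝ} {u : X → ℝ}

theorem Dominated.laxOleinik_le (h : Dominated c u) (x y : X) :
    laxOleinik c u y ≤ u x + c x y :=
  ciInf_le ⟨u y, by rintro _ ⟨z, rfl⟩; linarith [h z y]⟩ x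

theorem Dominated.le_laxOleinik [Nonempty X] (h : Dominated c u) (y : X) : u y ≤ laxOleinik c u y :=
  le_ciInf fun x => by linarith [h x y]

theorem exists_add_cost_lt [Nonempty X] (c : X → X → ℝ) (u : X → ℝ) (y : X) {ε : ℝ} (hε : 0 < ε) :
    ∃ x, u x + c x y < laxOleinik c u y + ε :=
  exists_lt_of_ciInf_lt (lt_add_of_pos_right _ hε)

theorem Dominated.laxOleinik [Nonempty X] (h : Dominated c u) : Dominated c (laxOleinik c u) :=
  fun x y => by linarith [h.laxOleinik_le x y, h.le_laxOleinik x]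

theorem Dominated.iterate [Nonempty X] (h : Dominated c u) (n : ℕ) :
    Dominated c ((_root_.laxOleinik c)^[n] u) := by
  induction n with
  | zero => exact h
  | succ n ih => rw [Function.iterate_succ_apply']; exact ih.laxOleinik

theorem Dominated.neg_swap (h : Dominated c u) :
    Dominated (fun x y => c y x) (fun x => -u x) := fun x y => by
  linarith [h y x]

end Domination

section InfConvolution

variable {E : Type*} [NormedAddCommGroup E] [InnerProductSpace ℝ E]

/-- `f` is semiconcave with constant `k`: `k‖·‖² - f` is convex. -/
def SemiconcaveWith (k : ℝ) (f : E → ℝ) : Prop :=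
  ∀ ⦃x y : E⦄ ⦃a b : ℝ⦄, 0 ≤ a → 0 ≤ b → a + b = 1 →
    a * f x + b * f y - f (a • x + b • y) ≤ a * b * (k * ‖x - y‖ ^ 2)

/-- `f` is semiconvex with constant `k`: `f + k‖·‖²` is convex. -/
def SemiconvexWith (k : ℝ) (f : E → ℝ) : Prop :=
  ∀ ⦃x y : E⦄ ⦃a b : ℝ⦄, 0 ≤ a → 0 ≤ b → a + b = 1 →
    -(a * b * (k * ‖x - y‖ ^ 2)) ≤ a * f x + b * f y - f (a • x + b • y)

theorem SemiconcaveWith.neg {k : ℝ} {f : E → ℝ} (hf : SemiconcaveWith k f) :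
    SemiconvexWith k (fun x => -f x) := by
  intro x y a b ha hb hab
  have := hf (x := x) (y := y) ha hb hab
  linarith

theorem SemiconvexWith.neg {k : ℝ} {f : E → ℝ} (hf : SemiconvexWith k f) :
    SemiconcaveWith k (fun x => -f x) := by
  intro x y a b ha hb hab
  have := hf (x := x) (y := y) ha hb hab
  linarith

theorem SemiconcaveWith.mono {k l : ℝ} {f : E → ℝ} (hf : SemiconcaveWith k f) (hkl : k ≤ l) :
    SemiconcaveWith l f := fun _ _ _ _ ha hb hab =>
  (hf ha hb hab).trans (by gcongr)

theorem SemiconvexWith.mono {k l : ℝ} {f : E → ℝ} (hf : SemiconvexWith k f) (hkl : k ≤ l) :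
    SemiconvexWith l f := fun _ _ _ _ ha hb hab =>
  le_trans (by gcongr) (hf ha hb hab)

/-- Upper bound on the second differences of a cost of duration `τ`. -/
def CostUpper (D τ : ℝ) (c : E → E → ℝ) : Prop :=
  ∀ ⦃x₁ x₂ y₁ y₂ : E⦄ ⦃a b : ℝ⦄, 0 ≤ a → 0 ≤ b → a + b = 1 →
    a * c x₁ y₁ + b * c x₂ y₂ - c (a • x₁ + b • x₂) (a • y₁ + b • y₂) ≤
      a * b * (D * (‖(y₁ - y₂) - (x₁ - x₂)‖ ^ 2 / τ + τ * ‖x₁ - x₂‖ ^ 2))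

/-- Lower bound on the second differences of a cost of duration `τ`. -/
def CostLower (D τ : ℝ) (c : E → E → ℝ) : Prop :=
  ∀ ⦃x₁ x₂ y₁ y₂ : E⦄ ⦃a b : ℝ⦄, 0 ≤ a → 0 ≤ b → a + b = 1 →
    a * b * (‖(y₁ - y₂) - (x₁ - x₂)‖ ^ 2 / (D * τ) - D * τ * ‖y₁ - y₂‖ ^ 2) ≤
      a * c x₁ y₁ + b * c x₂ y₂ - c (a • x₁ + b • x₂) (a • y₁ + b • y₂)

variable {c : E → E → ℝ} {u : E → ℝ}

theorem SemiconcaveWith.laxOleinik_step {D τ k θ : ℝ} (hc : CostUpper D τ c)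
    (h : Dominated c u) (hk : θ = 0 ∨ SemiconcaveWith k u) :
    SemiconcaveWith (θ ^ 2 * k + D * ((1 - θ) ^ 2 / τ + τ * θ ^ 2)) (laxOleinik c u) := by
  intro y₁ y₂ a b ha hb hab
  refine le_of_forall_pos_le_add fun ε hε => ?_
  obtain ⟨x, hx⟩ := exists_add_cost_lt c u (a • y₁ + b • y₂) hε
  set h₀ := y₁ - y₂ with hh₀
  set x₁ := x + (b * θ) • h₀ with hx₁
  set x₂ := x - (a * θ) • h₀ with hx₂
  have hb' : b = 1 - a := by linarith
  have hmid : a • x₁ + b • x₂ = x := by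
    rw [hx₁, hx₂, hb']; module
  have hdiff : x₁ - x₂ = θ • h₀ := by
    rw [hx₁, hx₂, hb']; module
  have hu : a * u x₁ + b * u x₂ - u x ≤ a * b * (θ ^ 2 * k * ‖h₀‖ ^ 2) := by
    rcases hk with rfl | hk
    · simp only [mul_zero, zero_smul, add_zero, sub_zero] at hx₁ hx₂
      rw [hx₁, hx₂, hb']
      apply le_of_eq; ring
    · have := hk (x := x₁) (y := x₂) ha hb hab
      rw [hmid, hdiff, norm_smul, mul_pow, Real.norm_eq_abs, sq_abs] at this
      linarith
  have hcc := hc (x₁ := x₁) (x₂ := x₂) (y₁ := y₁) (y₂ := y₂) ha hb hab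
  have hδ : (y₁ - y₂) - (x₁ - x₂) = (1 - θ) • h₀ := by rw [hdiff, hh₀]; module
  rw [hδ, hmid, hdiff, norm_smul, norm_smul, mul_pow, mul_pow, Real.norm_eq_abs,
    Real.norm_eq_abs, sq_abs, sq_abs] at hcc
  have h1 := mul_le_mul_of_nonneg_left (h.laxOleinik_le x₁ y₁) ha
  have h2 := mul_le_mul_of_nonneg_left (h.laxOleinik_le x₂ y₂) hb
  have e : a * b * ((θ ^ 2 * k + D * ((1 - θ) ^ 2 / τ + τ * θ ^ 2)) * ‖h₀‖ ^ 2) =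
    a * b * (θ ^ 2 * k * ‖h₀‖ ^ 2) +
    a * b * (D * ((1 - θ) ^ 2 * ‖h₀‖ ^ 2 / τ + τ * (θ ^ 2 * ‖h₀‖ ^ 2))) := by ring
  rw [e]
  linarith

/-- The discrete Lax-Oleinik semigroup regularizes to semiconcave functions. -/
theorem SemiconcaveWith.iterate {D τ : ℝ} (hD : 0 ≤ D) (hτ : 0 < τ) (hc : CostUpper D τ c)
    (h : Dominated c u) (n : ℕ) :
    SemiconcaveWith (D / ((n + 1) * τ) + D * ((n + 1) * τ)) ((laxOleinik c)^[n + 1] u) := by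
  induction n with
  | zero =>
    have := SemiconcaveWith.laxOleinik_step (k := 0) (θ := 0) hc h (Or.inl rfl)
    refine this.mono ?_
    have : 0 ≤ D * τ := by positivity
    simp only [CharP.cast_eq_zero]
    have e : D / ((0 + 1) * τ) = D * (1 / τ) := by field_simp; simp
    rw [e]; linarith
  | succ n ih =>
    rw [Function.iterate_succ_apply']
    have := SemiconcaveWith.laxOleinik_step (θ := (n + 1) / (n + 2)) hc (h.iterate (n + 1))
      (Or.inr ih)
    refine this.mono ?_
    push_cast
    have hθ : ((n : ℝ) + 1) / (n + 2) ≤ 1 := by rw [div_le_one (by positivity)]; linarith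
    have hθ2 : (((n : ℝ) + 1) / (n + 2)) ^ 2 ≤ 1 := pow_le_one₀ (by positivity) hθ
    have e : (((n : ℝ) + 1) / (n + 2)) ^ 2 * (D / ((n + 1) * τ) + D * ((n + 1) * τ)) +
      D * ((1 - ((n : ℝ) + 1) / (n + 2)) ^ 2 / τ + τ * (((n : ℝ) + 1) / (n + 2)) ^ 2) =
      D / ((n + 1 + 1) * τ) + (((n : ℝ) + 1) / (n + 2)) ^ 2 * (D * ((n + 1 + 1) * τ)) := by
      field_simp; ring
    rw [e]
    have : 0 ≤ D * (((n : ℝ) + 1 + 1) * τ) := by positivity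
    nlinarith

theorem SemiconvexWith.laxOleinik_step {D τ k : ℝ} (hD : 0 < D) (hτ : 0 < τ) (hk : 0 < k)
    (hkτ : 2 * D * k * τ ≤ 1) (hc : CostLower D τ c)
    (h : Dominated c u) (hu : SemiconvexWith k u) :
    SemiconvexWith (k + (2 * D * k ^ 2 + D) * τ) (laxOleinik c u) := by
  intro y₁ y₂ a b ha hb hab
  refine le_of_forall_pos_le_add fun ε hε => ?_
  obtain ⟨x₁, hx₁⟩ := exists_add_cost_lt c u y₁ hε
  obtain ⟨x₂, hx₂⟩ := exists_add_cost_lt c u y₂ hε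
  have hcc := hc (x₁ := x₁) (x₂ := x₂) (y₁ := y₁) (y₂ := y₂) ha hb hab
  have huu := hu (x := x₁) (y := x₂) ha hb hab
  have hle := h.laxOleinik_le (a • x₁ + b • x₂) (a • y₁ + b • y₂)
  have h1 := mul_le_mul_of_nonneg_left hx₁.le ha
  have h2 := mul_le_mul_of_nonneg_left hx₂.le hb
  set δ := (y₁ - y₂) - (x₁ - x₂) with hδ
  have hx : ‖x₁ - x₂‖ ≤ ‖y₁ - y₂‖ + ‖δ‖ := by
    have : x₁ - x₂ = (y₁ - y₂) - δ := by rw [hδ]; abel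
    rw [this]; exact norm_sub_le _ _
  have hab0 : 0 ≤ a * b := mul_nonneg ha hb
  have key : k * ‖x₁ - x₂‖ ^ 2 ≤ (k + 2 * D * k ^ 2 * τ) * ‖y₁ - y₂‖ ^ 2
      + ‖δ‖ ^ 2 / (D * τ) := by
    have hn : ‖x₁ - x₂‖ ^ 2 ≤ (‖y₁ - y₂‖ + ‖δ‖) ^ 2 := by gcongr
    have h3 : k * ‖x₁ - x₂‖ ^ 2 ≤ k * (‖y₁ - y₂‖ + ‖δ‖) ^ 2 := by gcongr
    refine h3.trans ?_
    set Y := ‖y₁ - y₂‖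
    set Z := ‖δ‖
    have hs : 0 < D * τ := by positivity
    rw [← sub_nonneg]
    have e : (k + 2 * D * k ^ 2 * τ) * Y ^ 2 + Z ^ 2 / (D * τ) - k * (Y + Z) ^ 2 =
      (2 * (D * τ * k * Y) ^ 2 - 2 * (D * τ * k * Y) * Z + Z ^ 2 / 2
        + Z ^ 2 * (1 - 2 * D * k * τ) / 2) / (D * τ) := by
      field_simp; ring
    rw [e]
    apply div_nonneg _ hs.le
    have : 0 ≤ Z ^ 2 * (1 - 2 * D * k * τ) := mul_nonneg (sq_nonneg _) (by linarith)
    nlinarith [sq_nonneg (2 * (D * τ * k * Y) - Z)]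
  have key2 := mul_le_mul_of_nonneg_left key hab0
  have hε' : a * ε + b * ε = ε := by rw [← add_mul, hab, one_mul]
  have e : a * b * ((k + (2 * D * k ^ 2 + D) * τ) * ‖y₁ - y₂‖ ^ 2) =
    a * b * ((k + 2 * D * k ^ 2 * τ) * ‖y₁ - y₂‖ ^ 2 + ‖δ‖ ^ 2 / (D * τ)) -
    a * b * (‖δ‖ ^ 2 / (D * τ) - D * τ * ‖y₁ - y₂‖ ^ 2) := by ring
  rw [e]
  linarith

/-- The discrete Lax-Oleinik semigroup preserves semiconvexity for short times. -/
theorem SemiconvexWith.iterate {D τ k : ℝ} (hD : 0 < D) (hτ : 0 < τ) (hk : 0 < k)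
    (hkτ : 4 * D * k * τ ≤ 1) (hc : CostLower D τ c)
    (h : Dominated c u) (hu : SemiconvexWith k u) (n : ℕ)
    (hn : n * τ * (8 * D * k ^ 2 + D) ≤ k) :
    SemiconvexWith (k + n * τ * (8 * D * k ^ 2 + D)) ((laxOleinik c)^[n] u) := by
  induction n with
  | zero => simpa using hu
  | succ n ih =>
    rw [Function.iterate_succ_apply']
    push_cast at hn ⊢
    set B := 8 * D * k ^ 2 + D with hB
    have hB0 : 0 < B := by positivity
    have hτB : 0 < τ * B := by positivity
    have hn' : n * τ * B ≤ k := by linarith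
    have hn0 : 0 ≤ n * τ * B := by positivity
    have hl : k + n * τ * B ≤ 2 * k := by linarith
    have := SemiconvexWith.laxOleinik_step (k := k + n * τ * B) hD hτ (by linarith) ?_ hc
      (h.iterate n) (ih hn')
    · refine this.mono ?_
      have : (k + n * τ * B) ^ 2 ≤ (2 * k) ^ 2 := by gcongr
      have : 2 * D * (k + n * τ * B) ^ 2 + D ≤ B := by
        have := mul_le_mul_of_nonneg_left this hD.le
        rw [hB]; linarith
      have := mul_le_mul_of_nonneg_right this hτ.le
      linarith
    · have : 2 * D * (k + n * τ * B) * τ ≤ 2 * D * (2 * k) * τ := by gcongr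
      linarith

end InfConvolution

section Tonelli

variable {E : Type*} [NormedAddCommGroup E] [InnerProductSpace ℝ E]

/-- Quantitative form of the standing hypotheses on the Hamiltonian: two-sided bounds on the
second differences, uniform convexity in `p`, and quadratic growth. -/
structure IsTonelli (C : ℝ) (H : E → E → ℝ) : Prop where
  one_le : 1 ≤ C
  upper : ∀ ⦃x₁ x₂ p₁ p₂ : E⦄ ⦃a b : ℝ⦄, 0 ≤ a → 0 ≤ b → a + b = 1 →
    a * H x₁ p₁ + b * H x₂ p₂ - H (a • x₁ + b • x₂) (a • p₁ + b • p₂) ≤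
      a * b * (C * (‖x₁ - x₂‖ ^ 2 + ‖p₁ - p₂‖ ^ 2))
  lower : ∀ ⦃x₁ x₂ p₁ p₂ : E⦄ ⦃a b : ℝ⦄, 0 ≤ a → 0 ≤ b → a + b = 1 →
    a * b * (‖p₁ - p₂‖ ^ 2 / C - C * ‖x₁ - x₂‖ ^ 2) ≤
      a * H x₁ p₁ + b * H x₂ p₂ - H (a • x₁ + b • x₂) (a • p₁ + b • p₂)
  growth_lower : ∀ x p, ‖p‖ ^ 2 / C - C ≤ H x p
  growth_upper : ∀ x p, H x p ≤ C * (‖p‖ ^ 2 + 1)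

/-- The Legendre transform of `H` in the momentum variable. -/
noncomputable def lagrangian (H : E → E → ℝ) (x v : E) : ℝ := ⨆ p, ⟪p, v⟫ - H x p

variable {C : ℝ} {H : E → E → ℝ}

theorem inner_le_sq (p v : E) {C : ℝ} (hC : 0 < C) : ⟪p, v⟫ ≤ ‖p‖ ^ 2 / C + C * ‖v‖ ^ 2 / 4 := by
  have h1 := real_inner_le_norm p v
  have e : ‖p‖ ^ 2 / C + C * ‖v‖ ^ 2 / 4 - ‖p‖ * ‖v‖ = (‖p‖ - C * ‖v‖ / 2) ^ 2 / C := by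
    field_simp; ring
  have : 0 ≤ (‖p‖ - C * ‖v‖ / 2) ^ 2 / C := by positivity
  linarith

namespace IsTonelli

theorem pos (h : IsTonelli C H) : 0 < C := zero_lt_one.trans_le h.one_le

theorem fenchel_bound (h : IsTonelli C H) (x p v : E) :
    ⟪p, v⟫ - H x p ≤ C * ‖v‖ ^ 2 / 4 + C := by
  have := inner_le_sq p v h.pos
  have := h.growth_lower x p
  linarith

theorem fenchel (h : IsTonelli C H) (x p v : E) : ⟪p, v⟫ - H x p ≤ lagrangian H x v :=
  le_ciSup (f := fun p => ⟪p, v⟫ - H x p)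
    ⟨C * ‖v‖ ^ 2 / 4 + C, by rintro _ ⟨q, rfl⟩; exact h.fenchel_bound x q v⟩ p

theorem lagrangian_le (h : IsTonelli C H) (x v : E) :
    lagrangian H x v ≤ C * ‖v‖ ^ 2 / 4 + C :=
  ciSup_le fun p => h.fenchel_bound x p v

theorem exists_lt_lagrangian (H : E → E → ℝ) (x v : E) {ε : ℝ} (hε : 0 < ε) :
    ∃ p, lagrangian H x v < ⟪p, v⟫ - H x p + ε := by
  obtain ⟨p, hp⟩ := exists_lt_of_lt_ciSup (sub_lt_self (lagrangian H x v) hε)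
  exact ⟨p, by linarith⟩

theorem inner_convexComb (p₁ p₂ v₁ v₂ : E) {a b : ℝ} (hab : a + b = 1) :
    a * ⟪p₁, v₁⟫ + b * ⟪p₂, v₂⟫ - ⟪a • p₁ + b • p₂, a • v₁ + b • v₂⟫ =
      a * b * ⟪p₁ - p₂, v₁ - v₂⟫ := by
  have hb : b = 1 - a := by linarith
  subst hb
  simp only [inner_add_left, inner_add_right, inner_sub_left, inner_sub_right,
    real_inner_smul_left, real_inner_smul_right]
  ring

theorem lagrangian_upper (h : IsTonelli C H) {x₁ x₂ v₁ v₂ : E} {a b : ℝ} (ha : 0 ≤ a)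
    (hb : 0 ≤ b) (hab : a + b = 1) :
    a * lagrangian H x₁ v₁ + b * lagrangian H x₂ v₂ -
      lagrangian H (a • x₁ + b • x₂) (a • v₁ + b • v₂) ≤
      a * b * (C * (‖x₁ - x₂‖ ^ 2 + ‖v₁ - v₂‖ ^ 2)) := by
  refine le_of_forall_pos_le_add fun ε hε => ?_
  obtain ⟨p₁, hp₁⟩ := exists_lt_lagrangian H x₁ v₁ hε
  obtain ⟨p₂, hp₂⟩ := exists_lt_lagrangian H x₂ v₂ hε
  have h1 := mul_le_mul_of_nonneg_left hp₁.le ha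
  have h2 := mul_le_mul_of_nonneg_left hp₂.le hb
  have h3 := h.fenchel (a • x₁ + b • x₂) (a • p₁ + b • p₂) (a • v₁ + b • v₂)
  have h4 := h.lower (x₁ := x₁) (x₂ := x₂) (p₁ := p₁) (p₂ := p₂) ha hb hab
  have h5 := inner_convexComb p₁ p₂ v₁ v₂ hab
  have h6 := mul_le_mul_of_nonneg_left (inner_le_sq (p₁ - p₂) (v₁ - v₂) h.pos)
    (mul_nonneg ha hb)
  have hε' : a * ε + b * ε = ε := by rw [← add_mul, hab, one_mul]
  have h7 : 0 ≤ a * b * (C * ‖v₁ - v₂‖ ^ 2) := by have := h.pos; positivity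
  linarith

theorem lagrangian_lower (h : IsTonelli C H) {x₁ x₂ v₁ v₂ : E} {a b : ℝ} (ha : 0 ≤ a)
    (hb : 0 ≤ b) (hab : a + b = 1) :
    a * b * (‖v₁ - v₂‖ ^ 2 / (4 * C) - C * ‖x₁ - x₂‖ ^ 2) ≤
    a * lagrangian H x₁ v₁ + b * lagrangian H x₂ v₂ -
      lagrangian H (a • x₁ + b • x₂) (a • v₁ + b • v₂) := by
  refine le_of_forall_pos_le_add fun ε hε => ?_
  obtain ⟨p, hp⟩ := exists_lt_lagrangian H (a • x₁ + b • x₂) (a • v₁ + b • v₂) hε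
  have hC := h.pos
  have hb' : b = 1 - a := by linarith
  set r := (1 / (2 * C)) • (v₁ - v₂) with hr
  set p₁ := p + b • r with hp₁
  set p₂ := p - a • r with hp₂
  have hmid : a • p₁ + b • p₂ = p := by rw [hp₁, hp₂, hb']; module
  have hdiff : p₁ - p₂ = r := by rw [hp₁, hp₂, hb']; module
  have h1 := mul_le_mul_of_nonneg_left (h.fenchel x₁ p₁ v₁) ha
  have h2 := mul_le_mul_of_nonneg_left (h.fenchel x₂ p₂ v₂) hb
  have h4 := h.upper (x₁ := x₁) (x₂ := x₂) (p₁ := p₁) (p₂ := p₂) ha hb hab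
  have h5 := inner_convexComb p₁ p₂ v₁ v₂ hab
  rw [hmid, hdiff] at h4 h5
  have h6 : ⟪r, v₁ - v₂⟫ = ‖v₁ - v₂‖ ^ 2 / (2 * C) := by
    rw [hr, real_inner_smul_left, real_inner_self_eq_norm_sq]; ring
  have h7 : ‖r‖ ^ 2 = ‖v₁ - v₂‖ ^ 2 / (4 * C ^ 2) := by
    rw [hr, norm_smul, mul_pow, Real.norm_eq_abs, sq_abs]; field_simp; ring
  rw [h6] at h5
  rw [h7] at h4
  have e : a * b * (‖v₁ - v₂‖ ^ 2 / (4 * C) - C * ‖x₁ - x₂‖ ^ 2) =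
    a * b * (‖v₁ - v₂‖ ^ 2 / (2 * C)) -
      a * b * (C * (‖x₁ - x₂‖ ^ 2 + ‖v₁ - v₂‖ ^ 2 / (4 * C ^ 2))) := by
    field_simp; ring
  rw [e]
  linarith

end IsTonelli

/-- The action of the straight segment from `x` to `y` in time `τ`, with a defect `ε`. -/
noncomputable def stepCost (H : E → E → ℝ) (τ ε : ℝ) (x y : E) : ℝ :=
  τ * lagrangian H x (τ⁻¹ • (y - x)) + ε * τ

namespace IsTonelli

theorem stepCost_upper_aux (h : IsTonelli C H) {τ : ℝ} (ε : ℝ) (hτ : 0 < τ)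
    {x₁ x₂ y₁ y₂ : E} {a b : ℝ} (ha : 0 ≤ a) (hb : 0 ≤ b) (hab : a + b = 1) :
    a * stepCost H τ ε x₁ y₁ + b * stepCost H τ ε x₂ y₂ -
      stepCost H τ ε (a • x₁ + b • x₂) (a • y₁ + b • y₂) ≤
      a * b * (C * (‖(y₁ - y₂) - (x₁ - x₂)‖ ^ 2 / τ + τ * ‖x₁ - x₂‖ ^ 2)) := by
  have hb' : b = 1 - a := by linarith
  have h1 := h.lagrangian_upper (x₁ := x₁) (x₂ := x₂) (v₁ := τ⁻¹ • (y₁ - x₁))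
    (v₂ := τ⁻¹ • (y₂ - x₂)) ha hb hab
  have e1 : a • τ⁻¹ • (y₁ - x₁) + b • τ⁻¹ • (y₂ - x₂) =
      τ⁻¹ • ((a • y₁ + b • y₂) - (a • x₁ + b • x₂)) := by module
  have e2 : τ⁻¹ • (y₁ - x₁) - τ⁻¹ • (y₂ - x₂) = τ⁻¹ • ((y₁ - y₂) - (x₁ - x₂)) := by module
  rw [e1, e2, norm_smul, mul_pow, Real.norm_eq_abs, sq_abs] at h1
  have h2 := mul_le_mul_of_nonneg_left h1 hτ.le
  unfold stepCost
  have e : τ * (a * b * (C * (‖x₁ - x₂‖ ^ 2 + τ⁻¹ ^ 2 * ‖(y₁ - y₂) - (x₁ - x₂)‖ ^ 2))) =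
    a * b * (C * (‖(y₁ - y₂) - (x₁ - x₂)‖ ^ 2 / τ + τ * ‖x₁ - x₂‖ ^ 2)) := by
    field_simp; ring
  rw [e] at h2
  subst hb'
  linarith

theorem stepCost_upper (h : IsTonelli C H) {τ : ℝ} (ε : ℝ) (hτ : 0 < τ) :
    CostUpper (4 * C) τ (stepCost H τ ε) := by
  intro x₁ x₂ y₁ y₂ a b ha hb hab
  refine (h.stepCost_upper_aux ε hτ ha hb hab).trans ?_
  have := h.pos
  gcongr
  linarith

theorem stepCost_upper_swap (h : IsTonelli C H) {τ : ℝ} (ε : ℝ) (hτ : 0 < τ) (hτ1 : τ ≤ 1) :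
    CostUpper (4 * C) τ (fun x y => stepCost H τ ε y x) := by
  intro y₁ y₂ x₁ x₂ a b ha hb hab
  refine (h.stepCost_upper_aux ε hτ ha hb hab).trans ?_
  have hC := h.pos
  have e : (x₁ - x₂) - (y₁ - y₂) = -((y₁ - y₂) - (x₁ - x₂)) := by abel
  rw [e, norm_neg, mul_assoc 4 C]
  have hx : ‖x₁ - x₂‖ ≤ ‖y₁ - y₂‖ + ‖(y₁ - y₂) - (x₁ - x₂)‖ := by
    have : x₁ - x₂ = (y₁ - y₂) - ((y₁ - y₂) - (x₁ - x₂)) := by abel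
    conv_lhs => rw [this]
    exact norm_sub_le _ _
  set X := ‖x₁ - x₂‖ with hX
  set Y := ‖y₁ - y₂‖
  set Z := ‖(y₁ - y₂) - (x₁ - x₂)‖
  have hX0 : 0 ≤ X := norm_nonneg _
  have hX2 : X ^ 2 ≤ 2 * Y ^ 2 + 2 * Z ^ 2 := by
    have : X ^ 2 ≤ (Y + Z) ^ 2 := by gcongr
    nlinarith [sq_nonneg (Y - Z)]
  have hZ : τ * Z ^ 2 ≤ Z ^ 2 / τ := by
    rw [le_div_iff₀ hτ]
    have : τ * τ ≤ 1 := by nlinarith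
    nlinarith [sq_nonneg Z]
  have h0 : 0 ≤ a * b := mul_nonneg ha hb
  have h1 := mul_le_mul_of_nonneg_left hX2 hτ.le
  have h2 : 0 ≤ Z ^ 2 / τ := by positivity
  have h3 : 0 ≤ τ * Y ^ 2 := by positivity
  have h4 : Z ^ 2 / τ + τ * X ^ 2 ≤ 4 * (Z ^ 2 / τ + τ * Y ^ 2) := by linarith
  have h5 := mul_le_mul_of_nonneg_left h4 hC.le
  refine mul_le_mul_of_nonneg_left ?_ h0
  linarith

theorem stepCost_lower_swap (h : IsTonelli C H) {τ : ℝ} (ε : ℝ) (hτ : 0 < τ) :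
    CostLower (4 * C) τ (fun x y => stepCost H τ ε y x) := by
  intro y₁ y₂ x₁ x₂ a b ha hb hab
  have hb' : b = 1 - a := by linarith
  have hC := h.pos
  have h1 := h.lagrangian_lower (x₁ := x₁) (x₂ := x₂) (v₁ := τ⁻¹ • (y₁ - x₁))
    (v₂ := τ⁻¹ • (y₂ - x₂)) ha hb hab
  have e1 : a • τ⁻¹ • (y₁ - x₁) + b • τ⁻¹ • (y₂ - x₂) =
      τ⁻¹ • ((a • y₁ + b • y₂) - (a • x₁ + b • x₂)) := by module
  have e2 : τ⁻¹ • (y₁ - x₁) - τ⁻¹ • (y₂ - x₂) = τ⁻¹ • -((x₁ - x₂) - (y₁ - y₂)) := by module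
  rw [e1, e2, norm_smul, mul_pow, Real.norm_eq_abs, sq_abs, norm_neg] at h1
  have h2 := mul_le_mul_of_nonneg_left h1 hτ.le
  simp only [stepCost]
  have h0 : 0 ≤ a * b := mul_nonneg ha hb
  have e : τ * (a * b * (τ⁻¹ ^ 2 * ‖(x₁ - x₂) - (y₁ - y₂)‖ ^ 2 / (4 * C)
      - C * ‖x₁ - x₂‖ ^ 2)) =
    a * b * (‖(x₁ - x₂) - (y₁ - y₂)‖ ^ 2 / (4 * C * τ) - C * τ * ‖x₁ - x₂‖ ^ 2) := by
    field_simp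
  rw [e] at h2
  have h3 : a * b * (‖(x₁ - x₂) - (y₁ - y₂)‖ ^ 2 / (4 * C * τ)
      - 4 * C * τ * ‖x₁ - x₂‖ ^ 2) ≤
    a * b * (‖(x₁ - x₂) - (y₁ - y₂)‖ ^ 2 / (4 * C * τ) - C * τ * ‖x₁ - x₂‖ ^ 2) := by
    gcongr; linarith
  refine (h3.trans h2).trans (le_of_eq ?_)
  subst hb'
  ring

/-- Semiconcave sub-solutions are almost dominated by the short time costs. -/
theorem dominated_stepCost (h : IsTonelli C H) {w : E → ℝ} {p : E → E} {K R ε δ τ : ℝ}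
    (hw : ∀ x y, w y ≤ w x + ⟪p x, y - x⟫ + K * ‖y - x‖ ^ 2)
    (hp : ∀ x, ‖p x‖ ≤ R) (hH : ∀ x, H x (p x) ≤ δ) (hK : 0 ≤ K) (hτ : 0 < τ) (hδ : 0 ≤ δ)
    (hτ1 : 8 * C * K * τ ≤ 1) (hτ2 : 8 * C ^ 2 * K * τ * (2 * R ^ 2 + 1) ≤ ε) :
    Dominated (stepCost H τ (δ + ε)) w := by
  intro x y
  have hC := h.pos
  set v := τ⁻¹ • (y - x) with hv
  have hyx : y - x = τ • v := by rw [hv, smul_smul, mul_inv_cancel₀ hτ.ne', one_smul]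
  set η := 8 * C * K * τ with hη
  have hη0 : 0 ≤ η := by positivity
  have hR : 0 ≤ R := (norm_nonneg _).trans (hp x)
  set s : ℝ := (4 * C)⁻¹ with hs
  have h1 := h.lower (x₁ := x) (x₂ := x) (p₁ := p x) (p₂ := p x + s • v)
    (a := 1 - η) (b := η) (by linarith) hη0 (by ring)
  have ex : (1 - η) • x + η • x = x := by module
  have ep : (1 - η) • p x + η • (p x + s • v) = p x + (η * s) • v := by module
  rw [ex, ep] at h1
  simp only [sub_self, norm_zero] at h1
  have h1' : 0 ≤ (1 - η) * η * (‖p x - (p x + s • v)‖ ^ 2 / C - C * 0 ^ 2) := by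
    have : 0 ≤ 1 - η := by linarith
    have : 0 ≤ ‖p x - (p x + s • v)‖ ^ 2 / C := by positivity
    have e : ‖p x - (p x + s • v)‖ ^ 2 / C - C * 0 ^ 2 = ‖p x - (p x + s • v)‖ ^ 2 / C := by
      ring
    rw [e]; positivity
  have h2 := h.fenchel x (p x + (η * s) • v) v
  rw [inner_add_left, real_inner_smul_left, real_inner_self_eq_norm_sq] at h2
  have h3 : H x (p x + s • v) ≤ C * (2 * R ^ 2 + 1) + ‖v‖ ^ 2 / (8 * C) := by
    refine (h.growth_upper _ _).trans ?_
    have : ‖p x + s • v‖ ^ 2 ≤ 2 * R ^ 2 + 2 * (s ^ 2 * ‖v‖ ^ 2) := by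
      have e1 := norm_add_le (p x) (s • v)
      have e2 : ‖s • v‖ ^ 2 = s ^ 2 * ‖v‖ ^ 2 := by
        rw [norm_smul, mul_pow, Real.norm_eq_abs, sq_abs]
      have e3 : ‖p x + s • v‖ ^ 2 ≤ (R + ‖s • v‖) ^ 2 := by
        gcongr; linarith [hp x]
      nlinarith [sq_nonneg (R - ‖s • v‖)]
    have := mul_le_mul_of_nonneg_left this hC.le
    have e : C * (2 * (s ^ 2 * ‖v‖ ^ 2)) = ‖v‖ ^ 2 / (8 * C) := by
      rw [hs]; field_simp; ring
    linarith
  have h4 := mul_le_mul_of_nonneg_left h3 hη0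
  have h5 := mul_le_mul_of_nonneg_left (hH x) (show 0 ≤ 1 - η by linarith)
  have h6 : (1 - η) * δ ≤ δ := by nlinarith
  have h7 := hw x y
  rw [hyx, real_inner_smul_right, norm_smul, mul_pow, Real.norm_eq_abs, sq_abs] at h7
  have h8 : ⟪p x, v⟫ + K * τ * ‖v‖ ^ 2 ≤ lagrangian H x v + (δ + ε) := by
    have e1 : η * s * ‖v‖ ^ 2 = 2 * (K * τ * ‖v‖ ^ 2) := by
      rw [hη, hs]; field_simp; ring
    have e2 : η * (C * (2 * R ^ 2 + 1) + ‖v‖ ^ 2 / (8 * C)) =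
        8 * C ^ 2 * K * τ * (2 * R ^ 2 + 1) + K * τ * ‖v‖ ^ 2 := by
      rw [hη]; field_simp
    rw [e2] at h4
    rw [e1] at h2
    linarith
  have h9 := mul_le_mul_of_nonneg_left h8 hτ.le
  simp only [stepCost]
  rw [← hv]
  linarith

end IsTonelli

end Tonelli

section Regularity

variable {E : Type*} [NormedAddCommGroup E] [InnerProductSpace ℝ E]

theorem ConvexOn.exists_subgradient [FiniteDimensional ℝ E] {f : E → ℝ}
    (hf : ConvexOn ℝ univ f) (x : E) : ∃ v, ∀ y, f x + ⟪v, y - x⟫ ≤ f y := by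
  have : CompleteSpace E := FiniteDimensional.complete ℝ E
  have hcont : Continuous f := hf.locallyLipschitz.continuous
  have hopen : IsOpen {z : E × ℝ | f z.1 < z.2} :=
    isOpen_lt (hcont.comp continuous_fst) continuous_snd
  have hconv : Convex ℝ {z : E × ℝ | f z.1 < z.2} := by
    simpa using hf.convex_strict_epigraph
  obtain ⟨l, hl⟩ := geometric_hahn_banach_open_point hconv hopen
    (show (x, f x) ∉ {z : E × ℝ | f z.1 < z.2} by simp)
  have hsplit : ∀ y t, l (y, t) = l (y, 0) + t * l (0, 1) := fun y t => by
    have : ((y, t) : E × ℝ) = (y, 0) + t • (0, 1) := by simp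
    rw [this, map_add, map_smul, smul_eq_mul]
  set s := l (0, 1) with hs
  have hneg : s < 0 := by
    have := hl (x, f x + 1) (by simp)
    rw [hsplit x (f x + 1), hsplit x (f x)] at this
    linarith
  set g : E →L[ℝ] ℝ := l.comp (ContinuousLinearMap.inl ℝ E ℝ) with hg
  have hgl : ∀ y, l (y, 0) = g y := fun y => by simp [hg]
  refine ⟨(-s)⁻¹ • (InnerProductSpace.toDual ℝ E).symm g, fun y => ?_⟩
  have hle : g y + f y * s ≤ g x + f x * s := by
    refine le_of_forall_pos_le_add fun ε hε => ?_
    have hs' : 0 < ε / (-s) := div_pos hε (by linarith)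
    have := hl (y, f y + ε / (-s)) (by simpa using hs')
    rw [hsplit y, hsplit x, hgl, hgl] at this
    have e : ε / (-s) * s = -ε := by rw [div_neg, neg_mul, div_mul_cancel₀ _ hneg.ne]
    linarith
  rw [real_inner_smul_left, InnerProductSpace.toDual_symm_apply, map_sub]
  have h1 : (-s)⁻¹ * (g y - g x) ≤ f y - f x := by
    rw [inv_mul_le_iff₀ (by linarith)]
    linarith
  linarith

/-- `P` is a first order Taylor expansion of `u`, with quadratic error of constant `K`. -/
def HasTaylorBound (K : ℝ) (u : E → ℝ) (P : E → E) : Prop :=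
  ∀ x y, |u y - u x - ⟪P x, y - x⟫| ≤ K * ‖y - x‖ ^ 2

theorem norm_sq_convexComb (x y : E) {a b : ℝ} (hab : a + b = 1) :
    a * ‖x‖ ^ 2 + b * ‖y‖ ^ 2 - ‖a • x + b • y‖ ^ 2 = a * b * ‖x - y‖ ^ 2 := by
  have := IsTonelli.inner_convexComb x y x y hab
  simpa only [real_inner_self_eq_norm_sq] using this

theorem SemiconvexWith.exists_taylor_lower [FiniteDimensional ℝ E] {K : ℝ} {u : E → ℝ}
    (h : SemiconvexWith K u) (x : E) :
    ∃ v, ∀ y, u x + ⟪v, y - x⟫ - K * ‖y - x‖ ^ 2 ≤ u y := by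
  have hconv : ConvexOn ℝ univ (fun y => u y + K * ‖y - x‖ ^ 2) := by
    refine ⟨convex_univ, fun y _ z _ a b ha hb hab => ?_⟩
    have h1 := h (x := y) (y := z) ha hb hab
    have h2 := norm_sq_convexComb (y - x) (z - x) hab
    have e : a • (y - x) + b • (z - x) = a • y + b • z - x := by
      have : b = 1 - a := by linarith
      subst this; module
    rw [e, sub_sub_sub_cancel_right] at h2
    simp only [smul_eq_mul]
    have := congrArg (fun t => K * t) h2
    beta_reduce at this
    linarith
  obtain ⟨v, hv⟩ := hconv.exists_subgradient x
  refine ⟨v, fun y => ?_⟩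
  have := hv y
  simp only [sub_self, norm_zero] at this
  linarith

theorem eq_zero_of_inner_le_sq {v : E} {K : ℝ} (h : ∀ y, ⟪v, y⟫ ≤ K * ‖y‖ ^ 2) : v = 0 := by
  by_contra hv
  have hv' : 0 < ‖v‖ ^ 2 := by positivity
  have h1 := h ((1 / (2 * (|K| + 1))) • v)
  rw [real_inner_smul_right, real_inner_self_eq_norm_sq, norm_smul, mul_pow,
    Real.norm_eq_abs, sq_abs] at h1
  have h2 : 1 / (2 * (|K| + 1)) ≤ K * (1 / (2 * (|K| + 1))) ^ 2 := by
    have := le_of_mul_le_mul_right (by linarith : 1 / (2 * (|K| + 1)) * ‖v‖ ^ 2 ≤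
      K * (1 / (2 * (|K| + 1))) ^ 2 * ‖v‖ ^ 2) hv'
    exact this
  have hK : 0 < |K| + 1 := by positivity
  field_simp at h2
  have := le_abs_self K
  linarith [abs_nonneg K]

theorem exists_hasTaylorBound [FiniteDimensional ℝ E] {K : ℝ} {u : E → ℝ}
    (h₁ : SemiconvexWith K u) (h₂ : SemiconcaveWith K u) : ∃ P, HasTaylorBound K u P := by
  choose P hP using h₁.exists_taylor_lower
  choose Q hQ using h₂.neg.exists_taylor_lower
  refine ⟨P, fun x y => ?_⟩
  have hPQ : P x + Q x = 0 := by
    refine eq_zero_of_inner_le_sq (K := 2 * K) fun z => ?_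
    have h1 := hP x (x + z)
    have h2 := hQ x (x + z)
    rw [add_sub_cancel_left] at h1 h2
    rw [inner_add_left]
    linarith
  have h1 := hP x y
  have h2 := hQ x y
  rw [eq_neg_of_add_eq_zero_right hPQ, inner_neg_left] at h2
  rw [abs_le]
  constructor <;> linarith

namespace HasTaylorBound

variable {K : ℝ} {u : E → ℝ} {P : E → E}

theorem norm_sub_le (h : HasTaylorBound K u P) (x y : E) :
    ‖P x - P y‖ ≤ 6 * K * ‖x - y‖ := by
  rcases eq_or_ne (P x) (P y) with he | he
  · rcases eq_or_ne x y with rfl | hxy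
    · simp
    · have h1 := (abs_nonneg _).trans (h x y)
      have h2 : 0 < ‖y - x‖ ^ 2 := by
        have : y - x ≠ 0 := sub_ne_zero.2 hxy.symm
        positivity
      have hK : 0 ≤ K := nonneg_of_mul_nonneg_left h1 h2
      rw [he, sub_self, norm_zero]; positivity
  · have hn : 0 < ‖P x - P y‖ := norm_pos_iff.2 (sub_ne_zero.2 he)
    rcases eq_or_ne x y with rfl | hxy
    · simp at hn
    have hr : 0 < ‖x - y‖ := norm_pos_iff.2 (sub_ne_zero.2 hxy)
    set r := ‖x - y‖ with hrr
    set z := (r / ‖P x - P y‖) • (P x - P y) with hz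
    have hzn : ‖z‖ = r := by
      rw [hz, norm_smul, Real.norm_of_nonneg (by positivity), div_mul_cancel₀ _ hn.ne']
    have hinner : ⟪P x - P y, z⟫ = r * ‖P x - P y‖ := by
      rw [hz, real_inner_smul_right, real_inner_self_eq_norm_sq]; field_simp
    have h1 := abs_le.1 (h x (x + z))
    have h2 := abs_le.1 (h y (x + z))
    have h3 := abs_le.1 (h y x)
    rw [add_sub_cancel_left, hzn] at h1
    rw [← hrr] at h3
    have e : x + z - y = (x - y) + z := by abel
    rw [e, inner_add_right] at h2
    have hle : ‖x - y + z‖ ^ 2 ≤ (2 * r) ^ 2 := by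
      have := norm_add_le (x - y) z
      rw [hzn, ← hrr] at this
      gcongr; linarith
    have hK : 0 ≤ K := by
      have : 0 < r ^ 2 := by positivity
      have h4 : 0 ≤ K * r ^ 2 := by linarith
      exact nonneg_of_mul_nonneg_left h4 this
    have h4 := mul_le_mul_of_nonneg_left hle hK
    rw [inner_sub_left] at hinner
    have h5 : r * ‖P x - P y‖ ≤ r * (6 * K * r) := by
      linarith
    exact le_of_mul_le_mul_left h5 hr

theorem hasGradientAt [CompleteSpace E] (h : HasTaylorBound K u P) (x : E) :
    HasGradientAt u (P x) x := by
  rw [hasGradientAt_iff_isLittleO]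
  refine Asymptotics.IsBigO.trans_isLittleO (g := fun y => ‖y - x‖ ^ 2) ?_ ?_
  · refine Asymptotics.IsBigO.of_bound K (Filter.Eventually.of_forall fun y => ?_)
    rw [Real.norm_eq_abs, Real.norm_of_nonneg (by positivity)]
    exact h x y
  · have : (fun y : E => ‖y - x‖ ^ 2) = (fun z : E => ‖z‖ ^ 2) ∘ (fun y => y - x) := rfl
    rw [this]
    have h2 : (fun z : E => ‖z‖ ^ 2) =o[nhds 0] (fun z => z) :=
      Asymptotics.isLittleO_norm_pow_id one_lt_two
    refine h2.comp_tendsto ?_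
    have : Continuous fun y : E => y - x := by fun_prop
    simpa using this.tendsto x

end HasTaylorBound

namespace IsTonelli

variable {C : ℝ} {H : E → E → ℝ}

theorem convexOn (h : IsTonelli C H) (x : E) : ConvexOn ℝ univ (H x) := by
  refine ⟨convex_univ, fun p _ q _ a b ha hb hab => ?_⟩
  have h1 := h.lower (x₁ := x) (x₂ := x) (p₁ := p) (p₂ := q) ha hb hab
  rw [← add_smul, hab, one_smul, sub_self, norm_zero] at h1
  have hC := h.pos
  have h2 : 0 ≤ a * b * (‖p - q‖ ^ 2 / C - C * 0 ^ 2) := by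
    have : ‖p - q‖ ^ 2 / C - C * 0 ^ 2 = ‖p - q‖ ^ 2 / C := by ring
    rw [this]; positivity
  simp only [smul_eq_mul]
  linarith

theorem nonpos_of_forall_inner_le [FiniteDimensional ℝ E] (h : IsTonelli C H) {x p : E}
    (hp : ∀ v, ⟪p, v⟫ ≤ lagrangian H x v) : H x p ≤ 0 := by
  obtain ⟨v, hv⟩ := (h.convexOn x).exists_subgradient p
  have h1 : lagrangian H x v ≤ ⟪p, v⟫ - H x p := by
    refine ciSup_le fun q => ?_
    have := hv q
    rw [inner_sub_right, real_inner_comm, real_inner_comm p v] at this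
    linarith
  linarith [hp v]

theorem norm_sq_le_of_nonpos (h : IsTonelli C H) {x p : E} {δ : ℝ} (hp : H x p ≤ δ) :
    ‖p‖ ^ 2 ≤ C * (C + δ) := by
  have h1 := h.growth_lower x p
  have h2 : ‖p‖ ^ 2 / C ≤ C + δ := by linarith
  rwa [div_le_iff₀' h.pos] at h2

end IsTonelli

end Regularity

section Existence

variable {E : Type*} [NormedAddCommGroup E] [InnerProductSpace ℝ E]

theorem exists_tendsto_hyperfilter {F : Type*} [NormedAddCommGroup F] [ProperSpace F]
    (f : ℕ → F) (B : ℝ) (hf : ∀ n, ‖f n‖ ≤ B) :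
    ∃ l, Filter.Tendsto f (Filter.hyperfilter ℕ) (nhds l) := by
  obtain ⟨l, -, hl⟩ := (isCompact_closedBall (0 : F) B).ultrafilter_le_nhds'
    ((Filter.hyperfilter ℕ).map f) (by
      rw [Ultrafilter.mem_map]
      exact Filter.univ_mem' fun n => by simpa using hf n)
  exact ⟨l, hl⟩

theorem HasTaylorBound.inner_le_lagrangian {H : E → E → ℝ} {K τ ε : ℝ} {z : E → ℝ} {P : E → E}
    (h : HasTaylorBound K z P) (hτ : 0 < τ) (hd : Dominated (stepCost H τ ε) z) (x v : E) :
    ⟪P x, v⟫ ≤ lagrangian H x v + (ε + K * τ * ‖v‖ ^ 2) := by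
  have h1 := hd x (x + τ • v)
  have h2 := (abs_le.1 (h x (x + τ • v))).1
  rw [stepCost, add_sub_cancel_left, smul_smul, inv_mul_cancel₀ hτ.ne', one_smul] at h1
  rw [add_sub_cancel_left, real_inner_smul_right, norm_smul, mul_pow, Real.norm_eq_abs,
    sq_abs] at h2
  refine le_of_mul_le_mul_left ?_ hτ
  linarith

namespace IsTonelli

variable [FiniteDimensional ℝ E] {C : ℝ} {H : E → E → ℝ}

/-- Regularization of an almost sub-solution by the discrete Lax-Oleinik semigroups, with a
constant that does not depend on the sub-solution. -/
theorem exists_regularization (h : IsTonelli C H) :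
    ∃ K : ℝ, 0 ≤ K ∧ ∀ ⦃δ : ℝ⦄, 0 < δ → ∀ ⦃w : E → ℝ⦄ ⦃p : E → E⦄ ⦃k R : ℝ⦄, 0 ≤ k →
      (∀ x y, w y ≤ w x + ⟪p x, y - x⟫ + k * ‖y - x‖ ^ 2) →
      (∀ x, ‖p x‖ ≤ R) → (∀ x, H x (p x) ≤ δ) →
      ∃ (z : E → ℝ) (P : E → E) (τ : ℝ), 0 < τ ∧ τ < δ ∧ HasTaylorBound K z P ∧
        Dominated (stepCost H τ (2 * δ)) z := by
  have hC := h.pos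
  set D := 4 * C with hD
  have hD0 : 0 < D := by positivity
  set A := 8 * D * (2 * D) ^ 2 + D with hA
  have hA0 : 0 < A := by positivity
  obtain ⟨N, hN⟩ := exists_nat_ge (A / (2 * D) + 1)
  have hN0 : (0 : ℝ) < N := lt_of_lt_of_le (by positivity) hN
  refine ⟨max (2 * (2 * D)) (D * N + D / N), by positivity, ?_⟩
  intro δ hδ w p k R hk hw hp hH
  set t := min (min δ 1) (min (1 / (8 * C * k + 4 * D * (2 * D)))
    (δ / (8 * C ^ 2 * k * (2 * R ^ 2 + 1) + 1))) with ht
  have ht0 : 0 < t := by positivity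
  obtain ⟨j, hj⟩ := exists_nat_one_div_lt (mul_pos hN0 ht0)
  set τ : ℝ := 1 / (N * (j + 1)) with hτ
  have hτ0 : 0 < τ := by positivity
  have hτt : τ < t := by
    rw [hτ, ← div_div, div_right_comm, div_lt_iff₀ hN0, mul_comm]; exact hj
  have hτδ : τ < δ := hτt.trans_le ((min_le_left _ _).trans (min_le_left _ _))
  have hτ1 : τ < 1 := hτt.trans_le ((min_le_left _ _).trans (min_le_right _ _))
  have hτ2 : τ < 1 / (8 * C * k + 4 * D * (2 * D)) :=
    hτt.trans_le ((min_le_right _ _).trans (min_le_left _ _))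
  have hτ3 : τ < δ / (8 * C ^ 2 * k * (2 * R ^ 2 + 1) + 1) :=
    hτt.trans_le ((min_le_right _ _).trans (min_le_right _ _))
  rw [lt_div_iff₀ (by positivity)] at hτ2 hτ3
  have hk1 : 0 ≤ 8 * C * k * τ := by positivity
  have hk2 : 0 ≤ 4 * D * (2 * D) * τ := by positivity
  have hdom : Dominated (stepCost H τ (2 * δ)) w := by
    rw [two_mul]
    refine h.dominated_stepCost hw hp hH hk hτ0 hδ.le (by linarith) ?_
    linarith
  set c := stepCost H τ (2 * δ) with hc
  obtain ⟨n, hn⟩ : ∃ n, N * (j + 1) = n + 1 :=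
    Nat.exists_eq_succ_of_ne_zero (by
      have : N ≠ 0 := by rintro rfl; simp at hN0
      positivity)
  have hnτ : ((n : ℝ) + 1) * τ = 1 := by
    have : (N : ℝ) * (j + 1) = n + 1 := by exact_mod_cast hn
    rw [← this, hτ]; field_simp
  have hv := SemiconcaveWith.iterate hD0.le hτ0 (h.stepCost_upper (2 * δ) hτ0) hdom n
  rw [hnτ, ← hc] at hv
  have hvd := (hdom.iterate (n + 1)).neg_swap
  set v := (laxOleinik c)^[n + 1] w
  have hv' : SemiconvexWith (2 * D) (fun x => -v x) := (hv.mono (by linarith)).neg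
  have hjτ : ((j : ℝ) + 1) * τ = 1 / N := by rw [hτ]; field_simp
  have hs1 := SemiconcaveWith.iterate hD0.le hτ0 (h.stepCost_upper_swap (2 * δ) hτ0 hτ1.le)
    hvd j
  have hs2 := SemiconvexWith.iterate (n := j + 1) hD0 hτ0 (by positivity) (by linarith)
    (h.stepCost_lower_swap (2 * δ) hτ0) hvd hv' (by
      push_cast
      rw [hjτ, ← hA, one_div_mul_eq_div, div_le_iff₀ hN0]
      have : A / (2 * D) ≤ N := by linarith
      rwa [div_le_iff₀' (by positivity)] at this)
  have hzd := (hvd.iterate (j + 1)).neg_swap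
  set z := (laxOleinik (fun x y => stepCost H τ (2 * δ) y x))^[j + 1] (fun x => -v x)
  push_cast at hs2
  rw [hjτ] at hs1
  rw [hjτ, ← hA] at hs2
  have hAN : 1 / N * A ≤ 2 * D := by
    rw [one_div_mul_eq_div, div_le_iff₀ hN0]
    have : A / (2 * D) ≤ N := by linarith
    rwa [div_le_iff₀' (by positivity)] at this
  have hz1 : SemiconvexWith (max (2 * (2 * D)) (D * N + D / N)) (fun x => -z x) := by
    refine (hs1.mono ?_).neg
    rw [div_div_eq_mul_div, div_one, mul_one_div]
    exact le_max_right _ _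
  have hz2 : SemiconcaveWith (max (2 * (2 * D)) (D * N + D / N)) (fun x => -z x) :=
    (hs2.mono (le_max_of_le_left (by linarith))).neg
  obtain ⟨P, hP⟩ := exists_hasTaylorBound hz1 hz2
  exact ⟨_, P, τ, hτ0, hτδ, hP, hzd⟩

/-- A Hamiltonian admitting semiconcave almost sub-solutions at every positive level admits
a `C^{1,1}` sub-solution at level `0`. -/
theorem exists_subsolution (h : IsTonelli C H)
    (hw : ∀ δ : ℝ, 0 < δ → ∃ (w : E → ℝ) (p : E → E) (k R : ℝ), 0 ≤ k ∧
      (∀ x y, w y ≤ w x + ⟪p x, y - x⟫ + k * ‖y - x‖ ^ 2) ∧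
      (∀ x, ‖p x‖ ≤ R) ∧ (∀ x, H x (p x) ≤ δ)) :
    ∃ (K : ℝ) (u : E → ℝ) (P : E → E), HasTaylorBound K u P ∧ ∀ x, H x (P x) ≤ 0 := by
  obtain ⟨K, hK, hreg⟩ := h.exists_regularization
  have hreg' : ∀ n : ℕ, ∃ (z : E → ℝ) (P : E → E), HasTaylorBound K z P ∧
      ∀ x v, ⟪P x, v⟫ ≤ lagrangian H x v + (2 + K * ‖v‖ ^ 2) * (1 / ((n : ℝ) + 1)) := by
    intro n
    have hδ : (0 : ℝ) < 1 / ((n : ℝ) + 1) := by positivity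
    obtain ⟨w, p, k, R, hk, hwp, hp, hH⟩ := hw _ hδ
    obtain ⟨z, P, τ, hτ, hτδ, hP, hd⟩ := hreg hδ hk hwp hp hH
    refine ⟨z, P, hP, fun x v => (hP.inner_le_lagrangian hτ hd x v).trans ?_⟩
    have : K * τ * ‖v‖ ^ 2 ≤ K * (1 / ((n : ℝ) + 1)) * ‖v‖ ^ 2 := by gcongr
    linarith
  choose z P hP hL using hreg'
  have hC := h.pos
  have hPB : ∀ x n, ‖P n x‖ ≤ C / 4 + C + 2 + K := by
    intro x n
    rcases eq_or_ne (P n x) 0 with h0 | h0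
    · rw [h0, norm_zero]; positivity
    have hn : 0 < ‖P n x‖ := norm_pos_iff.2 h0
    have h1 := hL n x (‖P n x‖⁻¹ • P n x)
    have h2 := h.lagrangian_le x (‖P n x‖⁻¹ • P n x)
    have e : ‖‖P n x‖⁻¹ • P n x‖ = 1 := by
      rw [norm_smul, norm_inv, norm_norm, inv_mul_cancel₀ hn.ne']
    rw [e] at h1 h2
    rw [real_inner_smul_right, real_inner_self_eq_norm_sq, pow_two,
      inv_mul_cancel_left₀ hn.ne'] at h1
    have h3 : (1 : ℝ) / ((n : ℝ) + 1) ≤ 1 := by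
      rw [div_le_one (by positivity)]; linarith [Nat.cast_nonneg (α := ℝ) n]
    have h4 := mul_le_mul_of_nonneg_left h3 (show 0 ≤ 2 + K * 1 ^ 2 by positivity)
    linarith
  have hPlim := fun x => exists_tendsto_hyperfilter (fun n => P n x) _ (hPB x)
  choose Q hQ using hPlim
  have hzB : ∀ x n, ‖z n x - z n 0‖ ≤ (C / 4 + C + 2 + K) * ‖x‖ + K * ‖x‖ ^ 2 := by
    intro x n
    have h1 := abs_le.1 (hP n 0 x)
    have h2 := abs_le.1 (abs_real_inner_le_norm (P n 0) (x - 0))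
    rw [sub_zero] at h1 h2
    have h3 := mul_le_mul_of_nonneg_right (hPB 0 n) (norm_nonneg x)
    rw [Real.norm_eq_abs, abs_le]
    constructor <;> linarith
  have hzlim := fun x => exists_tendsto_hyperfilter (fun n => z n x - z n 0) _ (hzB x)
  choose u hu using hzlim
  refine ⟨K, u, Q, fun x y => ?_, fun x => h.nonpos_of_forall_inner_le fun v => ?_⟩
  · have ht := (((hu y).sub (hu x)).sub ((hQ x).inner (tendsto_const_nhds (x := y - x)))).abs
    refine le_of_tendsto ht (Filter.Eventually.of_forall fun n => ?_)
    have := hP n x y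
    rwa [sub_sub_sub_cancel_right]
  · have h0 : Filter.Tendsto (fun n : ℕ => (1 : ℝ) / ((n : ℝ) + 1)) (Filter.hyperfilter ℕ)
        (nhds 0) :=
      tendsto_one_div_add_atTop_nhds_zero_nat.mono_left Nat.hyperfilter_le_atTop
    have h1 := (h0.const_mul (2 + K * ‖v‖ ^ 2)).const_add (lagrangian H x v)
    rw [mul_zero, add_zero] at h1
    exact le_of_tendsto_of_tendsto' ((hQ x).inner tendsto_const_nhds) h1 fun n => hL n x v

end IsTonelli

end Existence

section Mollification

open MeasureTheory

variable {E : Type*} [NormedAddCommGroup E] [InnerProductSpace ℝ E] {C : ℝ} {H : E → E → ℝ}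

theorem IsTonelli.le_add_mul_norm_sub (h : IsTonelli C H) {x y p : E} {κ : ℝ} (hp : ‖p‖ ≤ κ)
    (hxy : ‖x - y‖ ≤ 1) : H x p ≤ H y p + ‖x - y‖ * (C * (κ ^ 2 + 3)) := by
  rcases eq_or_ne x y with rfl | hne
  · simp
  have hC := h.pos
  set s := ‖x - y‖ with hs
  have hs0 : 0 < s := norm_pos_iff.2 (sub_ne_zero.2 hne)
  set e := s⁻¹ • (x - y) with he
  have hnorm : ‖e‖ = 1 := by
    rw [he, norm_smul, norm_inv, norm_norm, inv_mul_cancel₀ hs0.ne']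
  have h1 := h.lower (x₁ := y) (x₂ := y + e) (p₁ := p) (p₂ := p) (sub_nonneg.2 hxy) hs0.le
    (sub_add_cancel 1 s)
  have e1 : (1 - s) • y + s • (y + e) = x := by
    rw [he, smul_add, smul_smul, mul_inv_cancel₀ hs0.ne', ← add_assoc, ← add_smul]
    simp
  have e2 : (1 - s) • p + s • p = p := by rw [← add_smul]; simp
  rw [e1, e2, sub_self, norm_zero, show y - (y + e) = -e by abel, norm_neg, hnorm] at h1
  have h2 := h.growth_upper (y + e) p
  have h3 : -C ≤ H y p := le_trans (by have := div_nonneg (sq_nonneg ‖p‖) hC.le; linarith)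
    (h.growth_lower y p)
  have h4 : C * (‖p‖ ^ 2 + 1) ≤ C * (κ ^ 2 + 1) := by gcongr
  have h5 : s * (H (y + e) p - H y p) ≤ s * (C * (κ ^ 2 + 1) + C) :=
    mul_le_mul_of_nonneg_left (by linarith) hs0.le
  have h6 : (1 - s) * s * C ≤ s * C :=
    mul_le_mul_of_nonneg_right (by nlinarith) hC.le
  norm_num at h1
  nlinarith

theorem upper_taylor_of_hasGradientAt [CompleteSpace E] {w : E → ℝ} {p : E → E} {L : ℝ}
    (hw : ∀ x, HasGradientAt w (p x) x) (hL : ∀ x y, ‖p x - p y‖ ≤ L * ‖x - y‖) (hL0 : 0 ≤ L)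
    (x y : E) : w y ≤ w x + ⟪p x, y - x⟫ + L * ‖y - x‖ ^ 2 := by
  have hmem : ∀ z ∈ segment ℝ x y, ‖z - x‖ ≤ ‖y - x‖ := by
    rintro z ⟨a, b, ha, hb, hab, rfl⟩
    have : a • x + b • y - x = b • (y - x) := by
      rw [← eq_sub_iff_add_eq] at hab
      subst hab
      module
    rw [this, norm_smul, Real.norm_of_nonneg hb]
    exact mul_le_of_le_one_left (norm_nonneg _) (by linarith)
  have := Convex.norm_image_sub_le_of_norm_hasFDerivWithin_le' (𝕜 := ℝ) (f := w)
    (f' := fun z => InnerProductSpace.toDual ℝ E (p z)) (φ := InnerProductSpace.toDual ℝ E (p x))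
    (C := L * ‖y - x‖) (fun z _ => (hw z).hasFDerivAt.hasFDerivWithinAt) (fun z hz => by
      rw [← map_sub, LinearIsometryEquiv.norm_map]
      exact (hL z x).trans (mul_le_mul_of_nonneg_left (hmem z hz) hL0))
    (convex_segment x y) (left_mem_segment ℝ x y) (right_mem_segment ℝ x y)
  rw [InnerProductSpace.toDual_apply_apply, Real.norm_eq_abs] at this
  have := (le_abs_self _).trans this
  nlinarith

variable [FiniteDimensional ℝ E] [MeasurableSpace E] [BorelSpace E] (μ : Measure E)
  [μ.IsAddHaarMeasure]

theorem norm_integral_smul_translate_sub_le {ρ : E → ℝ} {g : E → E} {ℓ : ℝ≥0} {κ r : ℝ}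
    (hρ : LipschitzWith ℓ ρ) (hsupp : ∀ z, z ∉ Metric.ball 0 r → ρ z = 0)
    (hg : ∀ x, ‖g x‖ ≤ κ) (hint : ∀ x, Integrable (fun z => ρ z • g (x + z)) μ) (x x' : E) :
    ‖(∫ z, ρ z • g (x + z) ∂μ) - ∫ z, ρ z • g (x' + z) ∂μ‖ ≤
      ℓ * κ * (2 * μ.real (Metric.ball 0 r)) * ‖x - x'‖ := by
  have hκ : 0 ≤ κ := (norm_nonneg _).trans (hg 0)
  have htrans : ∀ x, (∫ z, ρ z • g (x + z) ∂μ) = ∫ y, ρ (y - x) • g y ∂μ := fun x => by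
    rw [← integral_add_left_eq_self (fun y => ρ (y - x) • g y) x]
    simp
  have hint' : ∀ x, Integrable (fun y => ρ (y - x) • g y) μ := fun x => by
    have := (hint x).comp_sub_right x
    simpa using this
  rw [htrans, htrans, ← integral_sub (hint' x) (hint' x')]
  set s := Metric.ball x r ∪ Metric.ball x' r with hs
  rw [← setIntegral_eq_integral_of_forall_compl_eq_zero (s := s) fun y hy => ?_]
  · have hfin : μ s < ⊤ := lt_of_le_of_lt (measure_union_le _ _)
      (ENNReal.add_lt_top.2 ⟨measure_ball_lt_top, measure_ball_lt_top⟩)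
    have hvol : μ.real s ≤ 2 * μ.real (Metric.ball 0 r) := by
      refine (measureReal_union_le _ _).trans_eq ?_
      simp only [Measure.real, Measure.addHaar_ball_center]
      ring
    refine (norm_setIntegral_le_of_norm_le_const (C := ℓ * ‖x - x'‖ * κ) hfin
      fun y _ => ?_).trans ?_
    · rw [← sub_smul, norm_smul]
      refine mul_le_mul ?_ (hg y) (norm_nonneg _) (by positivity)
      have := hρ.norm_sub_le (y - x) (y - x')
      rwa [show y - x - (y - x') = -(x - x') by abel, norm_neg] at this
    · calc _ ≤ ℓ * ‖x - x'‖ * κ * (2 * μ.real (Metric.ball 0 r)) := by gcongr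
        _ = _ := by ring
  · simp only [hs, mem_union, not_or, Metric.mem_ball, dist_eq_norm] at hy
    rw [hsupp _ (by simpa using hy.1), hsupp _ (by simpa using hy.2), sub_self]

variable {μ} in
theorem hasGradientAt_mollify [CompleteSpace E] {ρ : E → ℝ} {v : E → ℝ} {κ : ℝ≥0}
    (hρ : Continuous ρ) (hc : HasCompactSupport ρ) (hv : LipschitzWith κ v) (x : E) :
    Integrable (fun z => ρ z • gradient v (x + z)) μ ∧
      HasGradientAt (fun x => ∫ z, ρ z * v (x + z) ∂μ) (∫ z, ρ z • gradient v (x + z) ∂μ) x := by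
  have hmeas : Measurable (gradient v) :=
    (InnerProductSpace.toDual ℝ E).symm.continuous.measurable.comp (measurable_fderiv ℝ v)
  have hbound : ∀ y, ‖gradient v y‖ ≤ κ := fun y => by
    rw [gradient, LinearIsometryEquiv.norm_map]
    exact norm_fderiv_le_of_lipschitz ℝ hv
  have hρi : Integrable ρ μ := hρ.integrable_of_hasCompactSupport hc
  have hint : Integrable (fun z => ρ z • gradient v (x + z)) μ :=
    hρi.smul_bdd κ (hmeas.comp (measurable_const_add x)).aestronglyMeasurable
      (.of_forall fun z => hbound _)
  have hdiff : ∀ᵐ z ∂μ, DifferentiableAt ℝ v (x + z) :=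
    (measurePreserving_add_left μ x).quasiMeasurePreserving.ae hv.ae_differentiableAt
  have hF : ∀ y, Continuous fun z => ρ z * v (y + z) := fun y =>
    hρ.mul (hv.continuous.comp (continuous_const.add continuous_id))
  have hFi : ∀ y, Integrable (fun z => ρ z * v (y + z)) μ := fun y =>
    (hF y).integrable_of_hasCompactSupport hc.mul_right
  have key := hasFDerivAt_integral_of_dominated_loc_of_lip (𝕜 := ℝ) (μ := μ)
    (F := fun y z => ρ z * v (y + z)) (x₀ := x) (bound := fun z => ρ z * κ) (s := univ)
    (F' := fun z => ρ z • fderiv ℝ v (x + z)) Filter.univ_mem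
    (.of_forall fun y => (hFi y).aestronglyMeasurable) (hFi x)
    (hρ.aestronglyMeasurable.smul
      ((measurable_fderiv ℝ v).comp (measurable_const_add x)).aestronglyMeasurable)
    (.of_forall fun z => ?_) (hρi.mul_const _) ?_
  · refine ⟨hint, ?_⟩
    suffices InnerProductSpace.toDual ℝ E (∫ z, ρ z • gradient v (x + z) ∂μ) =
        ∫ z, ρ z • fderiv ℝ v (x + z) ∂μ by
      rw [hasGradientAt_iff_hasFDerivAt, this]
      exact key.2
    ext y
    rw [InnerProductSpace.toDual_apply_apply, real_inner_comm, ← integral_inner hint,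
      ContinuousLinearMap.integral_apply key.1]
    refine integral_congr_ae (.of_forall fun z => ?_)
    simp only [real_inner_smul_right, smul_apply, smul_eq_mul, gradient]
    rw [real_inner_comm, InnerProductSpace.toDual_symm_apply]
  · rw [lipschitzOnWith_univ]
    refine LipschitzWith.of_dist_le_mul fun y y' => ?_
    have := hv.norm_sub_le (y + z) (y' + z)
    rw [add_sub_add_right_eq_sub] at this
    rw [dist_eq_norm, dist_eq_norm, ← mul_sub, norm_mul, Real.coe_nnabs, abs_mul, mul_assoc,
      Real.norm_eq_abs (ρ z)]
    gcongr
    simpa using this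
  · filter_upwards [hdiff] with z hz
    have h1 : HasFDerivAt (fun y => v (y + z)) (fderiv ℝ v (x + z)) x :=
      (hasFDerivAt_comp_add_right z).2 hz.hasFDerivAt
    exact h1.const_mul (ρ z)

/-- A Lipschitz sub-solution is approximated by smooth sub-solutions at higher levels, by
convolution. -/
theorem IsTonelli.exists_smooth_subsolution (h : IsTonelli C H) {v : E → ℝ} {κ : ℝ≥0} {a δ : ℝ}
    (hv : LipschitzWith κ v) (hsub : ∀ x, DifferentiableAt ℝ v x → H x (gradient v x) ≤ a)
    (hδ : 0 < δ) :
    ∃ (w : E → ℝ) (p : E → E) (k R : ℝ), 0 ≤ k ∧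
      (∀ x y, w y ≤ w x + ⟪p x, y - x⟫ + k * ‖y - x‖ ^ 2) ∧
      (∀ x, ‖p x‖ ≤ R) ∧ ∀ x, H x (p x) ≤ a + δ := by
  have : CompleteSpace E := FiniteDimensional.complete ℝ E
  let μ : Measure E := Measure.addHaar
  have hC := h.pos
  set D := C * ((κ : ℝ) ^ 2 + 3) with hD
  have hD0 : 0 < D := by positivity
  set r := min 1 (δ / D) with hr
  have hr0 : 0 < r := lt_min one_pos (div_pos hδ hD0)
  let φ : ContDiffBump (0 : E) := ⟨r / 2, r, by positivity, by linarith⟩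
  set ρ := φ.normed μ with hρ
  have hρc : Continuous ρ := φ.continuous_normed
  have hρs : HasCompactSupport ρ := φ.hasCompactSupport_normed
  have hρi : Integrable ρ μ := φ.integrable_normed
  have hρ0 : ∀ z, 0 ≤ ρ z := φ.nonneg_normed
  have hρ1 : ∫ z, ρ z ∂μ = 1 := φ.integral_normed
  have hsupp : ∀ z, z ∉ Metric.ball (0 : E) r → ρ z = 0 := fun z hz => by
    have := φ.support_normed_eq (μ := μ)
    by_contra hne
    exact hz (this ▸ (Function.mem_support.2 hne))
  obtain ⟨ℓ, hℓ⟩ := (φ.contDiff_normed (μ := μ) (n := 1)).lipschitzWith_of_hasCompactSupport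
    hρs (by simp)
  have hbound : ∀ y, ‖gradient v y‖ ≤ κ := fun y => by
    rw [gradient, LinearIsometryEquiv.norm_map]
    exact norm_fderiv_le_of_lipschitz ℝ hv
  have hgrad := hasGradientAt_mollify (μ := μ) hρc hρs hv
  set p : E → E := fun x => ∫ z, ρ z • gradient v (x + z) ∂μ with hp
  refine ⟨fun x => ∫ z, ρ z * v (x + z) ∂μ, p, ℓ * κ * (2 * μ.real (Metric.ball 0 r)), κ,
    by positivity, upper_taylor_of_hasGradientAt (fun x => (hgrad x).2)
      (norm_integral_smul_translate_sub_le μ hℓ hsupp hbound fun x => (hgrad x).1) (by positivity),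
    fun x => ?_, fun x => ?_⟩
  · calc ‖p x‖ ≤ ∫ z, ρ z * κ ∂μ := norm_integral_le_of_norm_le (hρi.mul_const _)
          (.of_forall fun z => by
            rw [norm_smul, Real.norm_of_nonneg (hρ0 z)]
            exact mul_le_mul_of_nonneg_left (hbound _) (hρ0 z))
      _ = κ := by rw [integral_mul_const, hρ1, one_mul]
  · obtain ⟨s, hs⟩ := (h.convexOn x).exists_subgradient (p x)
    have hdiff : ∀ᵐ z ∂μ, DifferentiableAt ℝ v (x + z) :=
      (measurePreserving_add_left μ x).quasiMeasurePreserving.ae hv.ae_differentiableAt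
    have hi : Integrable (fun z => ⟪s, ρ z • gradient v (x + z)⟫) μ :=
      (hgrad x).1.const_inner s
    have hae : ∀ᵐ z ∂μ, ρ z * (H x (p x) - ⟪s, p x⟫) + ⟪s, ρ z • gradient v (x + z)⟫ ≤
        ρ z * (a + δ) := by
      filter_upwards [hdiff] with z hz
      by_cases hzr : z ∈ Metric.ball (0 : E) r
      · have hzn : ‖z‖ < r := by simpa using hzr
        have e1 := hs (gradient v (x + z))
        have e2 := h.le_add_mul_norm_sub (x := x) (y := x + z) (hbound (x + z))
          (by simpa using hzn.le.trans (min_le_left _ _))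
        have e3 := hsub _ hz
        have e4 : ‖x - (x + z)‖ * D ≤ δ := by
          rw [sub_add_cancel_left, norm_neg, ← le_div_iff₀ hD0]
          exact hzn.le.trans (min_le_right _ _)
        rw [real_inner_smul_right, ← mul_add]
        refine mul_le_mul_of_nonneg_left ?_ (hρ0 z)
        rw [inner_sub_right] at e1
        linarith
      · simp [hsupp z hzr]
    have := integral_mono_ae ((hρi.mul_const _).add hi) (hρi.mul_const _) hae
    rw [integral_add' (hρi.mul_const _) hi, integral_mul_const, integral_mul_const, hρ1,
      integral_inner (hgrad x).1] at this
    linarith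

end Mollification

section Superposition

variable {E : Type*} [NormedAddCommGroup E] [InnerProductSpace ℝ E] {C : ℝ} {H : E → E → ℝ}

theorem HasTaylorBound.mono {K K' : ℝ} {u : E → ℝ} {P : E → E} (h : HasTaylorBound K u P)
    (hK : K ≤ K') : HasTaylorBound K' u P :=
  fun x y => (h x y).trans (mul_le_mul_of_nonneg_right hK (sq_nonneg _))

theorem exists_weights (K : ℕ → ℝ) :
    ∃ c : ℕ → ℝ, (∀ n, 0 < c n) ∧ HasSum c 1 ∧ Summable fun n => c n * |K n| := by
  set a : ℕ → ℝ := fun n => (1 / 2) ^ n / (1 + |K n|) with ha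
  have hpos : ∀ n, 0 < a n := fun n => by positivity
  have hle : ∀ n, a n * (1 + |K n|) = (1 / 2) ^ n := fun n =>
    div_mul_cancel₀ _ (by positivity)
  have hsum : Summable a := Summable.of_nonneg_of_le (fun n => (hpos n).le)
    (fun n => by nlinarith [hle n, hpos n, abs_nonneg (K n)]) summable_geometric_two
  have hS : 0 < ∑' n, a n := hsum.tsum_pos (fun n => (hpos n).le) 0 (hpos 0)
  refine ⟨fun n => a n / ∑' n, a n, fun n => div_pos (hpos n) hS, ?_, ?_⟩
  · have := hsum.hasSum.div_const (∑' n, a n)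
    rwa [div_self hS.ne'] at this
  · have : Summable fun n => a n * |K n| := Summable.of_nonneg_of_le
      (fun n => mul_nonneg (hpos n).le (abs_nonneg _))
      (fun n => by nlinarith [hle n, hpos n, abs_nonneg (K n)]) summable_geometric_two
    refine (this.div_const (∑' n, a n)).congr fun n => ?_
    ring

namespace IsTonelli

theorem add_potential {φ : E → ℝ} {B : ℝ} (h : IsTonelli C H) (α : ℝ) (hφ0 : ∀ x, 0 ≤ φ x)
    (hφB : ∀ x, φ x ≤ B)
    (hφ : ∀ ⦃x y : E⦄ ⦃a b : ℝ⦄, 0 ≤ a → 0 ≤ b → a + b = 1 →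
      |a * φ x + b * φ y - φ (a • x + b • y)| ≤ a * b * (B * ‖x - y‖ ^ 2)) :
    IsTonelli (C + B + |α|) fun x p => H x p - α + φ x := by
  have hB : 0 ≤ B := (hφ0 0).trans (hφB 0)
  have hC := h.pos
  have hα := abs_nonneg α
  have hle : C ≤ C + B + |α| := by linarith
  have split : ∀ ⦃x₁ x₂ p₁ p₂ : E⦄ ⦃a b : ℝ⦄, a + b = 1 →
      a * (H x₁ p₁ - α + φ x₁) + b * (H x₂ p₂ - α + φ x₂) -
        (H (a • x₁ + b • x₂) (a • p₁ + b • p₂) - α + φ (a • x₁ + b • x₂)) =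
      (a * H x₁ p₁ + b * H x₂ p₂ - H (a • x₁ + b • x₂) (a • p₁ + b • p₂)) +
        (a * φ x₁ + b * φ x₂ - φ (a • x₁ + b • x₂)) := by
    intro x₁ x₂ p₁ p₂ a b hab
    obtain rfl : b = 1 - a := by linarith
    ring
  refine ⟨h.one_le.trans hle, ?_, ?_, fun x p => ?_, fun x p => ?_⟩
  · intro x₁ x₂ p₁ p₂ a b ha hb hab
    rw [split hab]
    refine (add_le_add (h.upper ha hb hab) ((abs_le.1 (hφ ha hb hab)).2)).trans ?_
    rw [← mul_add]
    refine mul_le_mul_of_nonneg_left ?_ (mul_nonneg ha hb)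
    nlinarith [mul_nonneg hα (sq_nonneg ‖x₁ - x₂‖), mul_nonneg hα (sq_nonneg ‖p₁ - p₂‖),
      mul_nonneg hB (sq_nonneg ‖p₁ - p₂‖)]
  · intro x₁ x₂ p₁ p₂ a b ha hb hab
    rw [split hab]
    refine le_trans ?_ (add_le_add (h.lower ha hb hab) ((abs_le.1 (hφ ha hb hab)).1))
    rw [← mul_neg, ← mul_add]
    refine mul_le_mul_of_nonneg_left ?_ (mul_nonneg ha hb)
    have := div_le_div_of_nonneg_left (sq_nonneg ‖p₁ - p₂‖) hC hle
    nlinarith [mul_nonneg hα (sq_nonneg ‖x₁ - x₂‖)]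
  · have := div_le_div_of_nonneg_left (sq_nonneg ‖p‖) hC hle
    linarith [h.growth_lower x p, hφ0 x, le_abs_self α]
  · nlinarith [h.growth_upper x p, hφB x, neg_abs_le α, mul_nonneg hα (sq_nonneg ‖p‖),
      mul_nonneg hB (sq_nonneg ‖p‖)]

variable [FiniteDimensional ℝ E]

/-- A countable convex combination of sub-solutions is strict wherever one of them is. -/
theorem exists_strict_superposition (h : IsTonelli C H) {α : ℝ} {K : ℕ → ℝ} {u : ℕ → E → ℝ}
    {P : ℕ → E → E} (hu : ∀ n, HasTaylorBound (K n) (u n) (P n))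
    (hsub : ∀ n x, H x (P n x) ≤ α) :
    ∃ (L : ℝ) (v : E → ℝ) (Q : E → E), HasTaylorBound L v Q ∧ (∀ x, H x (Q x) ≤ α) ∧
      ∀ n x, H x (P n x) < α → H x (Q x) < α := by
  have : CompleteSpace E := FiniteDimensional.complete ℝ E
  obtain ⟨c, hc, hc1, hcK⟩ := exists_weights K
  set R := √(C * (C + α)) with hR
  have hPR : ∀ n x, ‖P n x‖ ≤ R := fun n x =>
    Real.le_sqrt_of_sq_le (h.norm_sq_le_of_nonpos (hsub n x))
  have hsumP : ∀ x, Summable fun n => c n • P n x := fun x =>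
    Summable.of_norm_bounded (hc1.summable.mul_right R) fun n => by
      rw [norm_smul, Real.norm_of_nonneg (hc n).le]
      exact mul_le_mul_of_nonneg_left (hPR n x) (hc n).le
  have hsumu : ∀ x, Summable fun n => c n * (u n x - u n 0) := fun x => by
    refine Summable.of_norm_bounded ((hc1.summable.mul_right (R * ‖x‖)).add
      (hcK.mul_right (‖x‖ ^ 2))) fun n => ?_
    rw [norm_mul, Real.norm_of_nonneg (hc n).le, mul_assoc, ← mul_add]
    refine mul_le_mul_of_nonneg_left ?_ (hc n).le
    have h1 := (hu n).mono (le_abs_self _) 0 x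
    rw [sub_zero] at h1
    have h2 := (abs_real_inner_le_norm (P n 0) x).trans
      (mul_le_mul_of_nonneg_right (hPR n 0) (norm_nonneg x))
    rw [Real.norm_eq_abs, abs_le]
    rw [abs_le] at h1 h2
    constructor <;> linarith [h1.1, h1.2, h2.1, h2.2]
  have hinner : ∀ x z, HasSum (fun n => c n * ⟪P n x, z⟫) ⟪∑' n, c n • P n x, z⟫ := fun x z => by
    have := (innerSL ℝ z).hasSum (hsumP x).hasSum
    simpa only [innerSL_apply_apply, real_inner_smul_right, real_inner_comm] using this
  refine ⟨∑' n, c n * |K n|, fun x => ∑' n, c n * (u n x - u n 0), fun x => ∑' n, c n • P n x,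
    fun x y => ?_, ?_⟩
  · have h1 := ((hsumu y).hasSum.sub (hsumu x).hasSum).sub (hinner x (y - x))
    rw [← h1.tsum_eq, ← Real.norm_eq_abs]
    refine tsum_of_norm_bounded (hcK.hasSum.mul_right _) fun n => ?_
    rw [← mul_sub, ← mul_sub, norm_mul, Real.norm_of_nonneg (hc n).le, mul_assoc]
    refine mul_le_mul_of_nonneg_left ?_ (hc n).le
    have := (hu n).mono (le_abs_self _) x y
    rwa [Real.norm_eq_abs, sub_sub_sub_cancel_right]
  · have key : ∀ x, ∃ f : ℕ → ℝ, (∀ n, f n ≤ c n * H x (P n x)) ∧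
        HasSum f (H x (∑' n, c n • P n x)) := fun x => by
      obtain ⟨s, hs⟩ := (h.convexOn x).exists_subgradient (∑' n, c n • P n x)
      refine ⟨fun n => c n * (H x (∑' n, c n • P n x) - ⟪∑' n, c n • P n x, s⟫) +
        c n * ⟪P n x, s⟫, fun n => ?_, ?_⟩
      · have := hs (P n x)
        rw [inner_sub_right, real_inner_comm, real_inner_comm _ s] at this
        beta_reduce
        rw [← mul_add]
        refine mul_le_mul_of_nonneg_left ?_ (hc n).le
        linarith
      · have := (hc1.mul_right (H x (∑' n, c n • P n x) - ⟪∑' n, c n • P n x, s⟫)).add (hinner x s)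
        simpa using this
    have hα : HasSum (fun n => c n * α) α := by simpa using hc1.mul_right α
    refine ⟨fun x => ?_, fun n x hn => ?_⟩
    · obtain ⟨f, hf, hfs⟩ := key x
      exact hasSum_le (fun n => (hf n).trans
        (mul_le_mul_of_nonneg_left (hsub n x) (hc n).le)) hfs hα
    · obtain ⟨f, hf, hfs⟩ := key x
      exact hasSum_lt (fun n => (hf n).trans
        (mul_le_mul_of_nonneg_left (hsub n x) (hc n).le))
        ((hf n).trans_lt (mul_lt_mul_of_pos_left hn (hc n))) hfs hα

theorem exists_subsolution_of_lipschitz [MeasurableSpace E] [BorelSpace E] [CompleteSpace E]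
    (h : IsTonelli C H)
    (hv : ∀ ε, 0 < ε → ∃ (v : E → ℝ) (κ : ℝ≥0), LipschitzWith κ v ∧
      ∀ x, DifferentiableAt ℝ v x → H x (gradient v x) ≤ ε) :
    ∃ K u P, HasTaylorBound K u P ∧ ∀ x, H x (P x) ≤ 0 := by
  refine h.exists_subsolution fun δ hδ => ?_
  obtain ⟨v, κ, hκ, hsub⟩ := hv (δ / 2) (half_pos hδ)
  obtain ⟨w, p, k, R, hk, hw, hp, hH⟩ := h.exists_smooth_subsolution hκ hsub (half_pos hδ)
  exact ⟨w, p, k, R, hk, hw, hp, fun x => (hH x).trans_eq (add_halves δ)⟩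

end IsTonelli

end Superposition

section SecondDifference

variable {F : Type*} [NormedAddCommGroup F] [NormedSpace ℝ F]

theorem ContDiff.le_secondDifference {f : F → ℝ} (hf : ContDiff ℝ 2 f) {x y : F} {k : ℝ}
    (hk : ∀ z, k ≤ iteratedFDeriv ℝ 2 f z ![x - y, x - y]) {a b : ℝ} (ha : 0 ≤ a) (hb : 0 ≤ b)
    (hab : a + b = 1) : a * b * (k / 2) ≤ a * f x + b * f y - f (a • x + b • y) := by
  set h := x - y with hh
  have hline : ∀ t : ℝ, HasDerivAt (fun t : ℝ => y + t • h) h t := fun t => by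
    simpa using ((hasDerivAt_id t).smul_const h).const_add y
  have h1 : ∀ t, HasDerivAt (fun t : ℝ => f (y + t • h)) (fderiv ℝ f (y + t • h) h) t := fun t =>
    ((hf.differentiable (by norm_num)) _).hasFDerivAt.comp_hasDerivAt t (hline t)
  have h2 : ∀ t, HasDerivAt (fun t : ℝ => fderiv ℝ f (y + t • h) h)
      (fderiv ℝ (fderiv ℝ f) (y + t • h) h h) t := fun t => by
    have hd : Differentiable ℝ (fderiv ℝ f) :=
      (hf.fderiv_right (m := 1) (by norm_num)).differentiable (by norm_num)
    have := (hd (y + t • h)).hasFDerivAt.comp_hasDerivAt t (hline t)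
    simpa using this.clm_apply (hasDerivAt_const t h)
  have g1 : ∀ t, HasDerivAt (fun t : ℝ => f (y + t • h) - k / 2 * t ^ 2)
      (fderiv ℝ f (y + t • h) h - k * t) t := fun t => by
    refine ((h1 t).sub ((hasDerivAt_pow 2 t).const_mul (k / 2))).congr_deriv ?_
    norm_num
    ring
  have g2 : ∀ t, HasDerivAt (fun t : ℝ => fderiv ℝ f (y + t • h) h - k * t)
      (fderiv ℝ (fderiv ℝ f) (y + t • h) h h - k) t := fun t => by
    refine ((h2 t).sub ((hasDerivAt_id t).const_mul k)).congr_deriv ?_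
    rw [mul_one]
  have e1 : deriv (fun t : ℝ => f (y + t • h) - k / 2 * t ^ 2) =
      fun t => fderiv ℝ f (y + t • h) h - k * t := funext fun t => (g1 t).deriv
  have hconv := convexOn_univ_of_deriv2_nonneg (fun t => (g1 t).differentiableAt)
    (e1 ▸ fun t => (g2 t).differentiableAt) fun t => by
      rw [Function.iterate_succ, Function.iterate_one, Function.comp_apply, e1, (g2 t).deriv]
      have := hk (y + t • h)
      rw [iteratedFDeriv_two_apply] at this
      simpa using this
  have := hconv.2 (mem_univ 1) (mem_univ 0) ha hb hab
  have e2 : y + (a • 1 + b • 0 : ℝ) • h = a • x + b • y := by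
    obtain rfl : b = 1 - a := by linarith
    simp only [smul_eq_mul, mul_one, mul_zero, add_zero, hh]
    module
  have e3 : y + (1 : ℝ) • h = x := by simp [hh]
  simp only [e2, e3, zero_smul, add_zero] at this
  simp only [smul_eq_mul] at this
  obtain rfl : b = 1 - a := by linarith
  nlinarith

theorem ContDiff.secondDifference_le {f : F → ℝ} (hf : ContDiff ℝ 2 f) {x y : F} {k : ℝ}
    (hk : ∀ z, iteratedFDeriv ℝ 2 f z ![x - y, x - y] ≤ k) {a b : ℝ} (ha : 0 ≤ a) (hb : 0 ≤ b)
    (hab : a + b = 1) : a * f x + b * f y - f (a • x + b • y) ≤ a * b * (k / 2) := by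
  have := hf.neg.le_secondDifference (x := x) (y := y) (k := -k) (fun z => by
    rw [show (fun x => -f x) = -f from rfl, iteratedFDeriv_neg_apply]
    simpa using hk z) ha hb hab
  linarith

theorem abs_iteratedFDeriv_two_le (f : F → ℝ) (z v w : F) :
    |iteratedFDeriv ℝ 2 f z ![v, w]| ≤ ‖iteratedFDeriv ℝ 2 f z‖ * (‖v‖ * ‖w‖) := by
  simpa [Fin.prod_univ_two] using (iteratedFDeriv ℝ 2 f z).le_opNorm ![v, w]

theorem ContDiff.exists_secondDifference_bound {φ : F → ℝ} (hφ : ContDiff ℝ 2 φ)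
    (hc : HasCompactSupport φ) :
    ∃ B, ∀ B', B ≤ B' → ∀ ⦃x y : F⦄ ⦃a b : ℝ⦄, 0 ≤ a → 0 ≤ b → a + b = 1 →
      |a * φ x + b * φ y - φ (a • x + b • y)| ≤ a * b * (B' * ‖x - y‖ ^ 2) := by
  obtain ⟨B, hB⟩ := (hφ.continuous_iteratedFDeriv le_rfl).bounded_above_of_compact_support
    (hc.iteratedFDeriv 2)
  refine ⟨B, fun B' hB' x y a b ha hb hab => ?_⟩
  have hB0 : 0 ≤ B := (norm_nonneg _).trans (hB x)
  have hk : ∀ z, |iteratedFDeriv ℝ 2 φ z ![x - y, x - y]| ≤ B * ‖x - y‖ ^ 2 := fun z => by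
    refine (abs_iteratedFDeriv_two_le φ z _ _).trans ?_
    rw [← sq]
    exact mul_le_mul_of_nonneg_right (hB z) (sq_nonneg _)
  have hle : a * b * (B * ‖x - y‖ ^ 2 / 2) ≤ a * b * (B' * ‖x - y‖ ^ 2) := by
    refine mul_le_mul_of_nonneg_left ?_ (mul_nonneg ha hb)
    nlinarith [mul_nonneg hB0 (sq_nonneg ‖x - y‖),
      mul_le_mul_of_nonneg_right hB' (sq_nonneg ‖x - y‖)]
  have h1 := hφ.le_secondDifference (fun z => neg_le_of_abs_le (hk z)) ha hb hab
  have h2 := hφ.secondDifference_le (fun z => le_of_abs_le (hk z)) ha hb hab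
  rw [abs_le]
  constructor <;> linarith

end SecondDifference

section Tonelli

variable {E : Type*} [NormedAddCommGroup E] [InnerProductSpace ℝ E]

theorem isTonelli_of_contDiff {H : E → E → ℝ} (hH : ContDiff ℝ 2 fun x : E × E => H x.1 x.2)
    {m M : ℝ} (hm : 0 < m) (hmM : m ≤ M)
    (hd2H : ∀ x, ‖iteratedFDeriv ℝ 2 (fun y : E × E => H y.1 y.2) x‖ ≤ M)
    (hconv : ∀ q p v : E, m * ‖v‖ ^ 2 ≤ iteratedFDeriv ℝ 2 (fun p' => H q p') p ![v, v])
    (hlower : ∀ q p : E, m / 2 * ‖p‖ ^ 2 - M ≤ H q p)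
    (hupper : ∀ q p : E, H q p ≤ M / 2 * ‖p‖ ^ 2 + M) :
    ∃ C, IsTonelli C H := by
  set G : E × E → ℝ := fun y => H y.1 y.2 with hG
  have hM : 0 < M := hm.trans_le hmM
  have hpart : ∀ (z : E × E) (r : E), m * ‖r‖ ^ 2 ≤ iteratedFDeriv ℝ 2 G z ![(0, r), (0, r)] := by
    rintro ⟨q, p⟩ r
    refine (hconv q p r).trans_eq ?_
    have e : (fun p' => H q p') =
        (fun z => G ((q, 0) + z)) ∘ ContinuousLinearMap.inr ℝ E E := by
      ext p'; simp [hG]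
    have hG' : ContDiff ℝ 2 fun z => G ((q, 0) + z) :=
      hH.comp (contDiff_const.add contDiff_id)
    rw [e, ContinuousLinearMap.iteratedFDeriv_comp_right _ hG' _ le_rfl,
      iteratedFDeriv_comp_add_left, ContinuousMultilinearMap.compContinuousLinearMap_apply]
    congr 1
    · simp
    · ext i : 1
      fin_cases i <;> simp
  have hbil : ∀ (z v w : E × E), |iteratedFDeriv ℝ 2 G z ![v, w]| ≤ M * (‖v‖ * ‖w‖) :=
    fun z v w => (abs_iteratedFDeriv_two_le G z v w).trans
      (mul_le_mul_of_nonneg_right (hd2H z) (by positivity))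
  have hlow : ∀ (z v : E × E), m / 2 * ‖v.2‖ ^ 2 - (M + 2 * M ^ 2 / m) * ‖v.1‖ ^ 2 ≤
      iteratedFDeriv ℝ 2 G z ![v, v] := by
    rintro z ⟨s, r⟩
    have e : iteratedFDeriv ℝ 2 G z ![(s, r), (s, r)] =
        iteratedFDeriv ℝ 2 G z ![(s, 0), (s, 0)] + iteratedFDeriv ℝ 2 G z ![(s, 0), (0, r)] +
        (iteratedFDeriv ℝ 2 G z ![(0, r), (s, 0)] + iteratedFDeriv ℝ 2 G z ![(0, r), (0, r)]) := by
      simp only [iteratedFDeriv_two_apply, Matrix.cons_val_zero, Matrix.cons_val_one]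
      have : ((s, r) : E × E) = (s, 0) + (0, r) := by simp
      rw [this]
      simp only [map_add, add_apply]
      ring
    have h1 := neg_le_of_abs_le (hbil z (s, 0) (s, 0))
    have h2 := neg_le_of_abs_le (hbil z (s, 0) (0, r))
    have h3 := neg_le_of_abs_le (hbil z (0, r) (s, 0))
    have h4 := hpart z r
    simp only [Prod.norm_mk, norm_zero, norm_nonneg, sup_of_le_left, sup_of_le_right] at h1 h2 h3
    have h5 : 2 * M * (‖s‖ * ‖r‖) ≤ m / 2 * ‖r‖ ^ 2 + 2 * M ^ 2 / m * ‖s‖ ^ 2 := by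
      have : m / 2 * ‖r‖ ^ 2 + 2 * M ^ 2 / m * ‖s‖ ^ 2 - 2 * M * (‖s‖ * ‖r‖) =
          (m * ‖r‖ - 2 * M * ‖s‖) ^ 2 / (2 * m) := by field_simp; ring
      have := div_nonneg (sq_nonneg (m * ‖r‖ - 2 * M * ‖s‖)) (by positivity : 0 ≤ 2 * m)
      linarith
    rw [e]
    nlinarith
  have hq : 0 ≤ M ^ 2 / m := by positivity
  have hq' : 0 < 4 / m := by positivity
  set C := 1 + 4 / m + M + M ^ 2 / m with hC
  have hC0 : 0 < C := by positivity
  have hCm : ∀ t, t ^ 2 / C ≤ m / 4 * t ^ 2 := fun t => by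
    rw [div_le_iff₀ hC0]
    have : 1 ≤ m / 4 * C := by
      have : m / 4 * (4 / m) = 1 := by field_simp
      nlinarith [mul_nonneg hm.le hM.le, mul_nonneg hm.le hq]
    nlinarith [mul_le_mul_of_nonneg_right this (sq_nonneg t)]
  refine ⟨C, ⟨by linarith, ?_, ?_, fun x p => ?_, fun x p => ?_⟩⟩
  · intro x₁ x₂ p₁ p₂ a b ha hb hab
    have := hH.secondDifference_le (x := (x₁, p₁)) (y := (x₂, p₂))
      (k := M * (‖x₁ - x₂‖ ^ 2 + ‖p₁ - p₂‖ ^ 2)) (fun z => ?_) ha hb hab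
    · refine this.trans (mul_le_mul_of_nonneg_left ?_ (mul_nonneg ha hb))
      nlinarith [add_nonneg (sq_nonneg ‖x₁ - x₂‖) (sq_nonneg ‖p₁ - p₂‖)]
    · refine (le_of_abs_le (hbil z _ _)).trans (mul_le_mul_of_nonneg_left ?_ hM.le)
      rw [← sq, Prod.mk_sub_mk, Prod.norm_mk]
      rcases max_cases ‖x₁ - x₂‖ ‖p₁ - p₂‖ with h | h <;> rw [h.1] <;>
        nlinarith [sq_nonneg ‖x₁ - x₂‖, sq_nonneg ‖p₁ - p₂‖]
  · intro x₁ x₂ p₁ p₂ a b ha hb hab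
    have := hH.le_secondDifference (x := (x₁, p₁)) (y := (x₂, p₂))
      (fun z => hlow z _) ha hb hab
    refine le_trans (mul_le_mul_of_nonneg_left ?_ (mul_nonneg ha hb)) this
    simp only [Prod.mk_sub_mk]
    have h1 := hCm ‖p₁ - p₂‖
    have h2 : (M + 2 * M ^ 2 / m) / 2 ≤ C := by
      rw [add_div, mul_div_assoc, mul_div_cancel_left₀ _ two_ne_zero]
      linarith
    nlinarith [mul_le_mul_of_nonneg_right h2 (sq_nonneg ‖x₁ - x₂‖)]
  · nlinarith [hCm ‖p‖, hlower x p, mul_nonneg hm.le (sq_nonneg ‖p‖)]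
  · nlinarith [hupper x p, mul_nonneg (by linarith : 0 ≤ C - M / 2) (sq_nonneg ‖p‖)]

end Tonelli

section Strict

variable {E : Type*} [NormedAddCommGroup E] [InnerProductSpace ℝ E] [FiniteDimensional ℝ E]
  {C α : ℝ} {H : E → E → ℝ}

namespace IsTonelli

/-- Some `C^{1,1}` sub-solution is strict wherever one of them is. -/
theorem exists_maximally_strict_subsolution (h : IsTonelli C H)
    (hH : Continuous fun x : E × E => H x.1 x.2)
    (hne : ∃ K u P, HasTaylorBound K u P ∧ ∀ x, H x (P x) ≤ α) :
    ∃ (L : ℝ) (v : E → ℝ) (Q : E → E), HasTaylorBound L v Q ∧ (∀ x, H x (Q x) ≤ α) ∧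
      ∀ K u P q, HasTaylorBound K u P → (∀ x, H x (P x) ≤ α) → H q (P q) < α →
        H q (Q q) < α := by
  let I := {i : ℝ × (E → ℝ) × (E → E) //
    HasTaylorBound i.1 i.2.1 i.2.2 ∧ ∀ x, H x (i.2.2 x) ≤ α}
  have hopen : ∀ i : I, IsOpen {x | H x (i.1.2.2 x) < α} := fun i => by
    have : LipschitzWith (6 * i.1.1).toNNReal i.1.2.2 := LipschitzWith.of_dist_le_mul fun x y => by
      rw [dist_eq_norm, dist_eq_norm]
      exact (i.2.1.norm_sub_le x y).trans
        (mul_le_mul_of_nonneg_right (Real.le_coe_toNNReal _) (norm_nonneg _))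
    exact isOpen_lt (hH.comp (continuous_id.prodMk this.continuous)) continuous_const
  obtain ⟨T, hT, hcover⟩ := TopologicalSpace.isOpen_iUnion_countable _ hopen
  obtain ⟨K₀, u₀, P₀, hu₀, hP₀⟩ := hne
  obtain ⟨f, hf⟩ := (hT.insert (⟨(K₀, u₀, P₀), hu₀, hP₀⟩ : I)).exists_eq_range
    (insert_nonempty _ _)
  obtain ⟨L, v, Q, hv, hQ, hstrict⟩ := h.exists_strict_superposition (K := fun n => (f n).1.1)
    (u := fun n => (f n).1.2.1) (P := fun n => (f n).1.2.2) (fun n => (f n).2.1)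
    fun n => (f n).2.2
  refine ⟨L, v, Q, hv, hQ, fun K u P q hu hP hq => ?_⟩
  have hmem : q ∈ ⋃ i : I, {x | H x (i.1.2.2 x) < α} := mem_iUnion.2 ⟨⟨(K, u, P), hu, hP⟩, hq⟩
  rw [← hcover] at hmem
  obtain ⟨i, hi, hqi⟩ := mem_iUnion₂.1 hmem
  obtain ⟨n, rfl⟩ : i ∈ range f := hf ▸ mem_insert_of_mem _ hi
  exact hstrict n q hqi

variable [CompleteSpace E] [MeasurableSpace E] [BorelSpace E]

theorem exists_subsolution_add_potential (h : IsTonelli C H) {φ : E → ℝ} (hφ : ContDiff ℝ 2 φ)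
    (hc : HasCompactSupport φ) (hφ0 : ∀ x, 0 ≤ φ x)
    (hv : ∀ ε, 0 < ε → ∃ (v : E → ℝ) (κ : ℝ≥0), LipschitzWith κ v ∧
      ∀ x, DifferentiableAt ℝ v x → H x (gradient v x) + φ x ≤ α + ε) :
    ∃ K u P, HasTaylorBound K u P ∧ ∀ x, H x (P x) + φ x ≤ α := by
  obtain ⟨B, hB⟩ := hφ.exists_secondDifference_bound hc
  obtain ⟨B', hB'⟩ := hφ.continuous.bounded_above_of_compact_support hc
  have h' := h.add_potential α hφ0 (fun x => ((le_abs_self _).trans (hB' x)).trans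
    (le_max_right B B')) (hB _ (le_max_left B B'))
  obtain ⟨K, u, P, hu, hP⟩ := h'.exists_subsolution_of_lipschitz fun ε hε => by
    obtain ⟨v, κ, hκ, hsub⟩ := hv ε hε
    exact ⟨v, κ, hκ, fun x hx => by linarith [hsub x hx]⟩
  exact ⟨K, u, P, hu, fun x => by linarith [hP x]⟩

/-- A `C¹` sub-solution strict at a point gives a `C^{1,1}` sub-solution strict at that point. -/
theorem exists_subsolution_lt_of_contDiff (h : IsTonelli C H)
    (hH : Continuous fun x : E × E => H x.1 x.2) {w : E → ℝ} (hw : ContDiff ℝ 1 w)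
    (hsub : ∀ x, H x (gradient w x) ≤ α) {q : E} (hq : H q (gradient w q) < α) :
    ∃ K u P, HasTaylorBound K u P ∧ (∀ x, H x (P x) ≤ α) ∧ H q (P q) < α := by
  have hgrad : Continuous (gradient w) :=
    (InnerProductSpace.toDual ℝ E).symm.continuous.comp (hw.continuous_fderiv one_ne_zero)
  have hcont : Continuous fun x => H x (gradient w x) := hH.comp (continuous_id.prodMk hgrad)
  obtain ⟨β, hqβ, hβ⟩ := exists_between hq
  obtain ⟨r, hr, hball⟩ := Metric.isOpen_iff.1 (isOpen_Iio.preimage hcont : IsOpen _) q hqβ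
  let ψ : ContDiffBump q := ⟨r / 2, r, half_pos hr, half_lt_self hr⟩
  have hlip : LipschitzWith (√(C * (C + α))).toNNReal w := by
    refine lipschitzWith_of_nnnorm_fderiv_le (𝕜 := ℝ) (hw.differentiable one_ne_zero) fun x => ?_
    rw [← NNReal.coe_le_coe, coe_nnnorm, Real.coe_toNNReal _ (Real.sqrt_nonneg _),
      ← (InnerProductSpace.toDual ℝ E).symm.norm_map]
    exact Real.le_sqrt_of_sq_le (h.norm_sq_le_of_nonpos (hsub x))
  obtain ⟨K, u, P, hu, hP⟩ := h.exists_subsolution_add_potential (α := α)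
    (φ := fun x => (α - β) * ψ x) (contDiff_const.mul ψ.contDiff) ψ.hasCompactSupport.mul_left
    (fun x => mul_nonneg (sub_nonneg.2 hβ.le) ψ.nonneg) fun ε hε => by
      refine ⟨w, _, hlip, fun x _ => ?_⟩
      by_cases hx : x ∈ Metric.ball q r
      · have h1 : H x (gradient w x) < β := hball hx
        have h2 := mul_le_of_le_one_right (sub_nonneg.2 hβ.le) (ψ.le_one (x := x))
        linarith
      · have h1 : ψ x = 0 := ψ.zero_of_le_dist (by simpa using hx)
        rw [h1, mul_zero]
        linarith [hsub x]
  refine ⟨K, u, P, hu, fun x => ?_, ?_⟩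
  · have := mul_nonneg (sub_nonneg.2 hβ.le) (ψ.nonneg (x := x))
    linarith [hP x]
  · have h1 : ψ q = 1 := ψ.one_of_mem_closedBall (Metric.mem_closedBall_self ψ.rIn_pos.le)
    have := hP q
    rw [h1, mul_one] at this
    linarith

end IsTonelli

end Strict

/-- There exists a `C^{1,1}` critical sub-solution `u₀` which is strict
(`H(q, du₀(q)) < α`) outside the projected Aubry set `𝒜`. Here `α` is the critical value and
`𝒜` is the set of points where all `C¹` critical sub-solutions satisfy `H(q, dw(q)) = α`. -/
theorem strict_C11_critical_subsolution {d : ℕ}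
    (H : EuclideanSpace ℝ (Fin d) → EuclideanSpace ℝ (Fin d) → ℝ)
    (hH : ContDiff ℝ 2 (fun x : EuclideanSpace ℝ (Fin d) × EuclideanSpace ℝ (Fin d) =>
      H x.1 x.2))
    (m M : ℝ) (hm : 0 < m) (hmM : m ≤ M)
    (hd2H : ∀ x : EuclideanSpace ℝ (Fin d) × EuclideanSpace ℝ (Fin d),
      ‖iteratedFDeriv ℝ 2
        (fun y : EuclideanSpace ℝ (Fin d) × EuclideanSpace ℝ (Fin d) => H y.1 y.2) x‖ ≤ M)
    (hconv : ∀ q p v : EuclideanSpace ℝ (Fin d),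
      m * ‖v‖ ^ 2 ≤ iteratedFDeriv ℝ 2 (fun p' => H q p') p ![v, v])
    (hlower : ∀ q p : EuclideanSpace ℝ (Fin d), m / 2 * ‖p‖ ^ 2 - M ≤ H q p)
    (hupper : ∀ q p : EuclideanSpace ℝ (Fin d), H q p ≤ M / 2 * ‖p‖ ^ 2 + M)
    (α : ℝ)
    -- `α` is the critical value
    (hα : α = sInf {a : ℝ | ∃ v : EuclideanSpace ℝ (Fin d) → ℝ,
      (∃ K : ℝ≥0, LipschitzWith K v) ∧
      ∀ x, DifferentiableAt ℝ v x → H x (gradient v x) ≤ a}) :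
    ∃ u₀ : EuclideanSpace ℝ (Fin d) → ℝ,
      Differentiable ℝ u₀ ∧
      (∃ K : ℝ≥0, LipschitzWith K (fun q => gradient u₀ q)) ∧
      (∀ q, H q (gradient u₀ q) ≤ α) ∧
      -- strictness outside the projected Aubry set
      (∀ q : EuclideanSpace ℝ (Fin d),
        q ∉ {x : EuclideanSpace ℝ (Fin d) |
          ∀ w : EuclideanSpace ℝ (Fin d) → ℝ, ContDiff ℝ 1 w →
            (∀ y, H y (gradient w y) ≤ α) → H x (gradient w x) = α} →
        H q (gradient u₀ q) < α) := by
  obtain ⟨C, hC⟩ := isTonelli_of_contDiff hH hm hmM hd2H hconv hlower hupper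
  obtain ⟨K₀, w₀, P₀, hw₀, hP₀⟩ := hC.exists_subsolution_add_potential (α := α) (φ := fun _ => 0)
    contDiff_const HasCompactSupport.zero (fun _ => le_rfl) fun ε hε => by
      have hne : {a : ℝ | ∃ v : EuclideanSpace ℝ (Fin d) → ℝ, (∃ K : ℝ≥0, LipschitzWith K v) ∧
          ∀ x, DifferentiableAt ℝ v x → H x (gradient v x) ≤ a}.Nonempty :=
        ⟨M, fun _ => 0, ⟨0, LipschitzWith.const 0⟩, fun x _ => by
          simpa [gradient] using hupper x 0⟩
      obtain ⟨a, ⟨v, ⟨κ, hκ⟩, hsub⟩, ha⟩ := exists_lt_of_csInf_lt hne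
        (hα ▸ lt_add_of_pos_right α hε)
      exact ⟨v, κ, hκ, fun x hx => by linarith [hsub x hx]⟩
  obtain ⟨L, u, P, hu, hP, hstrict⟩ := hC.exists_maximally_strict_subsolution hH.continuous
    ⟨K₀, w₀, P₀, hw₀, fun x => by simpa using hP₀ x⟩
  have hgrad : gradient u = P := funext fun x => (hu.hasGradientAt x).gradient
  refine ⟨u, fun x => (hu.hasGradientAt x).differentiableAt, ⟨(6 * L).toNNReal, ?_⟩,
    fun q => hgrad ▸ hP q, fun q hq => ?_⟩
  · refine LipschitzWith.of_dist_le_mul fun x y => ?_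
    rw [hgrad, dist_eq_norm, dist_eq_norm]
    exact (hu.norm_sub_le x y).trans
      (mul_le_mul_of_nonneg_right (Real.le_coe_toNNReal _) (norm_nonneg _))
  · rw [mem_ofPred_eq] at hq
    push Not at hq
    obtain ⟨w, hw, hsub, hne⟩ := hq
    obtain ⟨K, v, Q, hv, hQ, hlt⟩ := hC.exists_subsolution_lt_of_contDiff hH.continuous hw hsub
      ((hsub q).lt_of_ne hne)
    rw [hgrad]
    exact hstrict K v Q q hv hQ hlt
end

section
/- Let H(q,p) : ℝ^d × ℝ^d → ℝ be a C² autonomous Hamiltonian satisfying: ‖d²H‖ ≤ M everywhere; ∂²_{pp} H ≥ m·Id in the sense of quadratic forms everywhere; (m/2)|p|² − M ≤ H(q,p) ≤ (M/2)|p|² + M everywhere, with 0 < m ≤ M; and H(q + w, p) = H(q, p) for every w ∈ ℤ^d, q ∈ ℝ^d, p ∈ ℝ^d. Then there exist a real number a and a ℤ^d-periodic Lipschitz function u : ℝ^d → ℝ which is a viscosity solution of H(q, du(q)) = a, i.e.: for every C¹ function φ : ℝ^d → ℝ and every point q at which u − φ attains a local maximum, H(q, dφ(q)) ≤ a; and for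 every C¹ function φ and every point q at which u − φ attains a local minimum, H(q, dφ(q)) ≥ a. -/
open scoped RealInnerProductSpace NNReal
open Set
open Filter Topology Metric

set_option linter.unusedSectionVars false

section
variable {E : Type*} [NormedAddCommGroup E] [InnerProductSpace ℝ E] [ProperSpace E]

lemma ContDiff.continuous_gradient {φ : E → ℝ} (hφ : ContDiff ℝ 1 φ) :
    Continuous (gradient φ) :=
  (InnerProductSpace.toDual ℝ E).symm.continuous.comp (hφ.continuous_fderiv one_ne_zero)

lemma norm_gradient_eq (φ : E → ℝ) (y : E) : ‖gradient φ y‖ = ‖fderiv ℝ φ y‖ := by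
  simp [gradient]

lemma gradient_add_norm_sub_sq {φ : E → ℝ} (hφ : ContDiff ℝ 1 φ) (c : ℝ) (q y : E) :
    gradient (fun z => φ z + c * ‖z - q‖ ^ 2) y = gradient φ y + (2 * c) • (y - q) := by
  have h1 : HasGradientAt φ (gradient φ y) y :=
    (hφ.differentiable one_ne_zero y).hasGradientAt
  have h2 : HasFDerivAt (fun z : E => ‖z - q‖ ^ 2) (2 • (innerSL ℝ (y - q))) y := by
    simpa using ((hasFDerivAt_id y).sub_const q).norm_sq
  apply HasGradientAt.gradient
  rw [hasGradientAt_iff_hasFDerivAt] at h1 ⊢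
  refine (h1.fun_add (h2.const_mul c)).congr_fderiv ?_
  ext z
  simp
  ring

lemma contDiff_add_norm_sub_sq {φ : E → ℝ} (hφ : ContDiff ℝ 1 φ) (c : ℝ) (q : E) :
    ContDiff ℝ 1 (fun z => φ z + c * ‖z - q‖ ^ 2) :=
  hφ.add (contDiff_const.mul ((contDiff_id.sub contDiff_const).norm_sq ℝ))

lemma gradient_comp_neg (φ : E → ℝ) (y : E) :
    gradient (fun z => -φ z) y = -gradient φ y := by
  simp [gradient, fderiv_fun_neg]

lemma exists_perturbed_test_max {u φ : E → ℝ} {q : E} (hφ : ContDiff ℝ 1 φ)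
    (hmax : IsLocalMax (fun y => u y - φ y) q) {ε : ℝ} (hε : 0 < ε) :
    ∃ δ > 0, ∀ v : E → ℝ, Continuous v → (∀ y ∈ closedBall q 1, v y ≤ u y + δ) →
      u q - δ ≤ v q → ∃ (y : E) (ψ : E → ℝ), ContDiff ℝ 1 ψ ∧
        IsLocalMax (fun z => v z - ψ z) y ∧ dist y q < ε ∧
        dist (gradient ψ y) (gradient φ q) < ε ∧ |v y - u q| < ε := by
  have e1 := hφ.continuous.continuousAt.eventually (Metric.ball_mem_nhds (φ q) (half_pos hε))
  have e2 := hφ.continuous_gradient.continuousAt.eventually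
    (Metric.ball_mem_nhds (gradient φ q) (half_pos hε))
  obtain ⟨r₀, hr₀, hr⟩ := Metric.eventually_nhds_iff.1 ((e1.and e2).and hmax)
  obtain ⟨r, hr0, hr1⟩ : ∃ r > 0, r < min (min r₀ 1) (ε / 4) := exists_between (by positivity)
  simp only [lt_min_iff] at hr1
  refine ⟨min (r ^ 2 / 4) (ε / 4), by positivity, fun v hv hvu hvq => ?_⟩
  set δ := min (r ^ 2 / 4) (ε / 4)
  have hδ1 : δ ≤ r ^ 2 / 4 := min_le_left _ _
  have hδ2 : δ ≤ ε / 4 := min_le_right _ _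
  obtain ⟨y, hy, hymax⟩ := (isCompact_closedBall q r).exists_isMaxOn
    ⟨q, mem_closedBall_self hr0.le⟩
    (hv.sub (contDiff_add_norm_sub_sq hφ 1 q).continuous).continuousOn
  have hyr : dist y q ≤ r := hy
  obtain ⟨⟨h1, h2⟩, h3⟩ := hr (lt_of_le_of_lt hyr hr1.1.1)
  have h4 : v q - φ q ≤ v y - (φ y + dist y q ^ 2) := by
    simpa [dist_eq_norm] using hymax (mem_closedBall_self hr0.le)
  have h5 := hvu y (hyr.trans hr1.1.2.le)
  simp only [Real.dist_eq, abs_lt] at h1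
  dsimp only at h3
  have h6 : 0 ≤ dist y q := dist_nonneg
  have hlt : dist y q < r := by
    by_contra! hcon
    nlinarith
  refine ⟨y, fun z => φ z + 1 * ‖z - q‖ ^ 2, contDiff_add_norm_sub_sq hφ 1 q,
    hymax.isLocalMax (closedBall_mem_nhds_of_mem hlt), by linarith, ?_, ?_⟩
  · rw [gradient_add_norm_sub_sq hφ, add_comm]
    calc dist ((2 * (1:ℝ)) • (y - q) + gradient φ y) (gradient φ q)
        ≤ dist ((2 * (1:ℝ)) • (y - q) + gradient φ y) (gradient φ y)
          + dist (gradient φ y) (gradient φ q) := dist_triangle _ _ _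
      _ < ε := by
        have : dist ((2 * (1:ℝ)) • (y - q) + gradient φ y) (gradient φ y) = 2 * dist y q := by
          simp [norm_smul, dist_eq_norm]
        have h2' : dist (gradient φ y) (gradient φ q) < ε / 2 := h2
        linarith
  · rw [abs_lt]
    constructor <;> nlinarith

lemma exists_perturbed_test_min {u φ : E → ℝ} {q : E} (hφ : ContDiff ℝ 1 φ)
    (hmin : IsLocalMin (fun y => u y - φ y) q) {ε : ℝ} (hε : 0 < ε) :
    ∃ δ > 0, ∀ v : E → ℝ, Continuous v → (∀ y ∈ closedBall q 1, u y - δ ≤ v y) →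
      v q ≤ u q + δ → ∃ (y : E) (ψ : E → ℝ), ContDiff ℝ 1 ψ ∧
        IsLocalMin (fun z => v z - ψ z) y ∧ dist y q < ε ∧
        dist (gradient ψ y) (gradient φ q) < ε ∧ |v y - u q| < ε := by
  have hmax : IsLocalMax (fun y => -u y - -φ y) q := by
    simpa only [neg_sub_neg, neg_sub] using hmin.neg
  obtain ⟨δ, hδ, h⟩ := exists_perturbed_test_max (u := fun y => -u y) hφ.neg hmax hε
  refine ⟨δ, hδ, fun v hv hvu hvq => ?_⟩
  obtain ⟨y, ψ, hψ, hy, hyq, hg, hvy⟩ := h (fun y => -v y) hv.neg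
    (fun y hy => by linarith [hvu y hy]) (by linarith)
  refine ⟨y, fun z => -ψ z, hψ.neg, ?_, hyq, ?_, ?_⟩
  · simpa only [sub_neg_eq_add, neg_sub, neg_add_eq_sub, add_comm] using hy.neg
  · rw [gradient_comp_neg] at hg ⊢
    rwa [← dist_neg_neg, neg_neg]
  · rwa [← abs_neg, neg_sub, ← neg_sub_neg]


/-- `v` is a viscosity subsolution of `l v + H(q, dv) = 0`. -/
def IsDiscountedSubsolution (H : E → E → ℝ) (l : ℝ) (v : E → ℝ) : Prop :=
  ∀ φ : E → ℝ, ContDiff ℝ 1 φ → ∀ q : E, IsLocalMax (fun y => v y - φ y) q →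
    l * v q + H q (gradient φ q) ≤ 0

/-- `v` is a viscosity supersolution of `l v + H(q, dv) = 0`. -/
def IsDiscountedSupersolution (H : E → E → ℝ) (l : ℝ) (v : E → ℝ) : Prop :=
  ∀ φ : E → ℝ, ContDiff ℝ 1 φ → ∀ q : E, IsLocalMin (fun y => v y - φ y) q →
    0 ≤ l * v q + H q (gradient φ q)

/-- The `K`-Lipschitz viscosity subsolutions of `l v + H(q, dv) = 0` bounded above by `B`. -/
def perronFamily (H : E → E → ℝ) (l : ℝ) (K : ℝ≥0) (B : ℝ) : Set (E → ℝ) :=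
  {v | LipschitzWith K v ∧ (∀ y, v y ≤ B) ∧ IsDiscountedSubsolution H l v}

/-- The upper envelope of `perronFamily`. -/
noncomputable def perronSup (H : E → E → ℝ) (l : ℝ) (K : ℝ≥0) (B : ℝ) (x : E) : ℝ :=
  sSup ((fun v : E → ℝ => v x) '' perronFamily H l K B)

lemma exists_forall_abs_sub_lt {H : E → E → ℝ} (hH : Continuous fun x : E × E => H x.1 x.2)
    (q p : E) {η : ℝ} (hη : 0 < η) :
    ∃ ε > 0, ∀ y p', dist y q < ε → dist p' p < ε → |H y p' - H q p| < η := by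
  obtain ⟨ε, hε, h⟩ := Metric.continuous_iff.1 hH (q, p) η hη
  refine ⟨ε, hε, fun y p' hy hp => ?_⟩
  simpa [Real.dist_eq] using h (y, p') (by simpa [Prod.dist_eq] using ⟨hy, hp⟩)

section Perron
variable {H : E → E → ℝ} {l B : ℝ} {K : ℝ≥0}

lemma le_perronSup {v : E → ℝ} (hv : v ∈ perronFamily H l K B) (x : E) :
    v x ≤ perronSup H l K B x :=
  le_csSup ⟨B, by rintro _ ⟨w, hw, rfl⟩; exact hw.2.1 x⟩ ⟨v, hv, rfl⟩

lemma perronSup_le (hne : (perronFamily H l K B).Nonempty) {x : E} {c : ℝ}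
    (h : ∀ v ∈ perronFamily H l K B, v x ≤ c) : perronSup H l K B x ≤ c :=
  csSup_le (hne.image _) (by rintro _ ⟨w, hw, rfl⟩; exact h w hw)

lemma exists_lt_of_lt_perronSup (hne : (perronFamily H l K B).Nonempty) {x : E} {c : ℝ}
    (h : c < perronSup H l K B x) : ∃ v ∈ perronFamily H l K B, c < v x := by
  by_contra! hcon
  exact (perronSup_le hne hcon).not_gt h

lemma lipschitzWith_perronSup (hne : (perronFamily H l K B).Nonempty) :
    LipschitzWith K (perronSup H l K B) :=
  LipschitzWith.of_le_add_mul K fun x y => perronSup_le hne fun v hv =>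
    (hv.1.le_add_mul x y).trans (by gcongr; exact le_perronSup hv y)

lemma isDiscountedSubsolution_perronSup (hH : Continuous fun x : E × E => H x.1 x.2)
    (hl : 0 < l) (hne : (perronFamily H l K B).Nonempty) :
    IsDiscountedSubsolution H l (perronSup H l K B) := by
  intro φ hφ q hq
  by_contra! hcon
  set c := l * perronSup H l K B q + H q (gradient φ q)
  obtain ⟨ε, hε, h⟩ := exists_forall_abs_sub_lt hH q (gradient φ q) (half_pos hcon)
  obtain ⟨δ, hδ, h'⟩ := exists_perturbed_test_max hφ hq
    (show 0 < min ε (c / 2 / l) by positivity)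
  obtain ⟨v, hv, hvq⟩ := exists_lt_of_lt_perronSup hne
    (show perronSup H l K B q - δ < perronSup H l K B q by linarith)
  obtain ⟨y, ψ, hψ, hy, hyq, hg, hvy⟩ := h' v hv.1.continuous
    (fun y _ => by linarith [le_perronSup hv y]) hvq.le
  have h1 := hv.2.2 ψ hψ y hy
  have h2 := h y _ (hyq.trans_le (min_le_left _ _)) (hg.trans_le (min_le_left _ _))
  have h3 := (abs_lt.1 (hvy.trans_le (min_le_right _ _))).1
  have h4 : l * (perronSup H l K B q - v y) < c / 2 := by
    rw [mul_comm, ← lt_div_iff₀ hl]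
    linarith
  linarith [(abs_lt.1 h2).1]

lemma comp_add_right_mem_perronFamily {t : E} (ht : ∀ q p, H (q + t) p = H q p) {v : E → ℝ}
    (hv : v ∈ perronFamily H l K B) : (fun y => v (y + t)) ∈ perronFamily H l K B := by
  refine ⟨?_, fun y => hv.2.1 _, fun φ hφ q hq => ?_⟩
  · exact LipschitzWith.of_le_add_mul K fun x y => by
      simpa using hv.1.le_add_mul (x + t) (y + t)
  · have h := hv.2.2 (fun y => φ (y - t)) (hφ.comp (contDiff_id.sub contDiff_const)) (q + t) ?_
    · rw [ht] at h
      convert h using 3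
      simp [gradient, fderiv_comp_sub]
    · have : IsLocalMax (fun y => v (y + t) - φ y) (q + t - t) := by simpa using hq
      simpa [Function.comp_def] using
        this.comp_continuous (g := fun y => y - t) (b := q + t) (by fun_prop)

lemma perronSup_add_right {t : E} (ht : ∀ q p, H (q + t) p = H q p) (q : E) :
    perronSup H l K B (q + t) = perronSup H l K B q := by
  rcases (perronFamily H l K B).eq_empty_or_nonempty with h | hne
  · simp [perronSup, h]
  have key : ∀ s : E, (∀ q p, H (q + s) p = H q p) → ∀ q,
      perronSup H l K B (q + s) ≤ perronSup H l K B q := fun s hs q =>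
    perronSup_le hne fun v hv => le_perronSup (comp_add_right_mem_perronFamily hs hv) q
  refine (key t ht q).antisymm ?_
  have hneg : ∀ q p, H (q + -t) p = H q p := fun q p => by
    rw [← ht (q + -t), neg_add_cancel_right]
  simpa using key (-t) hneg (q + t)

lemma lipschitzWith_ite_max {u ψ : E → ℝ} (hu : LipschitzWith K u) {q : E} {r s : ℝ}
    (hsr : s < r) (hψ : LipschitzOnWith K ψ (ball q r))
    (hle : ∀ y ∈ ball q r, s ≤ dist y q → ψ y ≤ u y) [DecidablePred (· ∈ ball q r)] :
    LipschitzWith K (fun y => if y ∈ ball q r then max (u y) (ψ y) else u y) := by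
  set w : E → ℝ := fun y => if y ∈ ball q r then max (u y) (ψ y) else u y with hw
  have huw : ∀ y, u y ≤ w y := fun y => by
    simp only [hw]
    split_ifs <;> simp
  have hψw : ∀ y ∈ ball q r, ψ y ≤ w y := fun y hy => by
    simp only [hw, if_pos hy, le_max_right]
  refine LipschitzWith.of_le_add_mul K fun x y => ?_
  by_cases hx : x ∈ ball q r ∧ u x < ψ x
  · have hxs : dist x q < s := by
      by_contra! hcon
      exact (hle x hx.1 hcon).not_gt hx.2
    have hwx : w x = ψ x := by
      simp only [hw, if_pos hx.1, max_eq_right hx.2.le]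
    rw [hwx]
    by_cases hy : y ∈ ball q r
    · exact (hψ.le_add_mul hx.1 hy).trans (by gcongr; exact hψw y hy)
    · have hyr : r ≤ dist y q := by simpa using hy
      have hcont : ContinuousOn (fun τ : ℝ => dist (AffineMap.lineMap x y τ) q) (Icc 0 1) :=
        (AffineMap.lineMap_continuous.dist continuous_const).continuousOn
      obtain ⟨τ, hτ, hτs⟩ := intermediate_value_Icc zero_le_one hcont
        (show s ∈ Icc _ _ by simpa using ⟨hxs.le, by linarith⟩)
      set z : E := AffineMap.lineMap x y τ with hz
      have hzr : z ∈ ball q r := by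
        rw [mem_ball]
        exact hτs.trans_lt hsr
      have h1 := hψ.le_add_mul hx.1 hzr
      have h2 := hle z hzr hτs.ge
      have h3 := hu.le_add_mul z y
      have h4 : dist x z + dist z y = dist x y := by
        rw [hz, dist_left_lineMap, dist_lineMap_right, Real.norm_of_nonneg hτ.1,
          Real.norm_of_nonneg (sub_nonneg.2 hτ.2)]
        ring
      rw [← h4]
      linarith [huw y, mul_add (K : ℝ) (dist x z) (dist z y)]
  · have hwx : w x = u x := by
      simp only [hw]
      split_ifs with h
      · exact max_eq_left (not_lt.1 fun h' => hx ⟨h, h'⟩)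
      · rfl
    rw [hwx]
    exact (hu.le_add_mul x y).trans (by gcongr; exact huw y)

lemma isDiscountedSubsolution_ite_max {u ψ : E → ℝ} (hu : IsDiscountedSubsolution H l u)
    {q : E} {r : ℝ} (hψ : ContDiff ℝ 1 ψ)
    (hneg : ∀ y ∈ ball q r, l * ψ y + H y (gradient ψ y) < 0)
    [DecidablePred (· ∈ ball q r)] :
    IsDiscountedSubsolution H l (fun y => if y ∈ ball q r then max (u y) (ψ y) else u y) := by
  set w : E → ℝ := fun y => if y ∈ ball q r then max (u y) (ψ y) else u y with hw
  have huw : ∀ y, u y ≤ w y := fun y => by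
    simp only [hw]
    split_ifs <;> simp
  intro φ hφ y hy
  by_cases hx : y ∈ ball q r ∧ u y < ψ y
  · have hwy : w y = ψ y := by
      simp only [hw, if_pos hx.1, max_eq_right hx.2.le]
    have hmax : IsLocalMax (fun z => ψ z - φ z) y := by
      filter_upwards [hy, isOpen_ball.mem_nhds hx.1] with z hz hzr
      have : ψ z ≤ w z := by simp only [hw, if_pos hzr, le_max_right]
      rw [hwy] at hz
      linarith
    have h0 : fderiv ℝ ψ y = fderiv ℝ φ y := by
      have := hmax.fderiv_eq_zero
      rwa [fderiv_fun_sub (hψ.differentiable one_ne_zero y) (hφ.differentiable one_ne_zero y),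
        sub_eq_zero] at this
    rw [hwy, gradient, ← h0]
    exact (hneg y hx.1).le
  · have hwy : w y = u y := by
      simp only [hw]
      split_ifs with h
      · exact max_eq_left (not_lt.1 fun h' => hx ⟨h, h'⟩)
      · rfl
    rw [hwy]
    refine hu φ hφ y ?_
    filter_upwards [hy] with z hz
    rw [hwy] at hz
    linarith [huw z]

lemma isDiscountedSupersolution_perronSup (hH : Continuous fun x : E × E => H x.1 x.2)
    {m M : ℝ} (hm : 0 < m) (hlower : ∀ q p, m / 2 * ‖p‖ ^ 2 - M ≤ H q p) (hl : 0 < l)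
    (hK : 4 * M ≤ m * K ^ 2) (hne : (perronFamily H l K (M / l)).Nonempty)
    (hbdd : ∀ y, -M ≤ l * perronSup H l K (M / l) y) :
    IsDiscountedSupersolution H l (perronSup H l K (M / l)) := by
  classical
  set u := perronSup H l K (M / l)
  intro φ hφ q hq
  by_contra! hcon
  set φ₁ : E → ℝ := fun y => φ y + (u q - φ q)
  have hφ₁ : ContDiff ℝ 1 φ₁ := hφ.add contDiff_const
  set ψ : E → ℝ := fun y => φ₁ y + (-1) * ‖y - q‖ ^ 2 with hψdef
  have hψ : ContDiff ℝ 1 ψ := contDiff_add_norm_sub_sq hφ₁ (-1) q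
  have hgψ : gradient ψ q = gradient φ q := by
    rw [hψdef, gradient_add_norm_sub_sq hφ₁]
    simp [φ₁, gradient]
  have hψq : ψ q = u q := by simp [hψdef, φ₁]
  set c := l * u q + H q (gradient φ q)
  have hgK : ‖gradient ψ q‖ < K := by
    have h1 := hlower q (gradient φ q)
    have h2 := hbdd q
    rw [hgψ]
    refine lt_of_pow_lt_pow_left₀ 2 K.2 (lt_of_mul_lt_mul_left ?_ hm.le)
    linarith
  have hcontG : Continuous fun y => l * ψ y + H y (gradient ψ y) :=
    (continuous_const.mul hψ.continuous).add
      (hH.comp (continuous_id.prodMk hψ.continuous_gradient))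
  have e1 : ∀ᶠ y in 𝓝 q, l * ψ y + H y (gradient ψ y) < c / 2 :=
    hcontG.continuousAt.eventually_lt_const (by
      beta_reduce
      rw [hψq, hgψ]
      linarith)
  have e2 : ∀ᶠ y in 𝓝 q, ‖gradient ψ y‖ < K :=
    hψ.continuous_gradient.norm.continuousAt.eventually_lt_const hgK
  obtain ⟨r, hr, hball⟩ := Metric.eventually_nhds_iff_ball.1 ((e1.and e2).and hq)
  obtain ⟨δ, hδ, hδ'⟩ : ∃ δ > 0, δ < min ((r / 2) ^ 2) (-c / 2 / l) :=
    exists_between (lt_min (by positivity) (div_pos (by linarith) hl))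
  obtain ⟨hδ1, hδ2⟩ := lt_min_iff.1 hδ'
  rw [lt_div_iff₀ hl] at hδ2
  have hg : ∀ y, gradient (fun z => ψ z + δ) y = gradient ψ y := fun y => by simp [gradient]
  have hneg : ∀ y ∈ ball q r, l * (ψ y + δ) + H y (gradient (fun z => ψ z + δ) y) < 0 := by
    intro y hy
    rw [hg]
    linarith [(hball y hy).1.1]
  set w : E → ℝ := fun y => if y ∈ ball q r then max (u y) (ψ y + δ) else u y with hw
  have hwmem : w ∈ perronFamily H l K (M / l) := by
    refine ⟨?_, fun y => ?_, ?_⟩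
    · refine lipschitzWith_ite_max (lipschitzWith_perronSup hne) (half_lt_self hr) ?_ ?_
      · refine (convex_ball q r).lipschitzOnWith_of_nnnorm_fderiv_le (𝕜 := ℝ)
          (fun y _ => (hψ.differentiable one_ne_zero y).add_const δ) fun y hy => ?_
        rw [← NNReal.coe_le_coe, coe_nnnorm, ← norm_gradient_eq, hg]
        exact (hball y hy).1.2.le
      · intro y hy hys
        have h1 : u q - φ q ≤ u y - φ y := (hball y hy).2
        have h2 : ψ y = φ y + (u q - φ q) - dist y q ^ 2 := by
          simp [hψdef, φ₁, dist_eq_norm]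
          ring
        have h3 : (r / 2) ^ 2 ≤ dist y q ^ 2 := by gcongr
        linarith
    · have hub : u y ≤ M / l := perronSup_le hne fun v hv => hv.2.1 y
      simp only [hw]
      split_ifs with h
      · refine max_le hub ?_
        rw [le_div_iff₀ hl]
        have h1 := hneg y h
        have h2 := hlower y (gradient (fun z => ψ z + δ) y)
        have h3 : 0 ≤ m / 2 * ‖gradient (fun z => ψ z + δ) y‖ ^ 2 := by positivity
        linarith
      · exact hub
    · exact isDiscountedSubsolution_ite_max (isDiscountedSubsolution_perronSup hH hl hne)
        (hψ.add contDiff_const) hneg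
  have h1 : w q ≤ u q := le_perronSup hwmem q
  have h2 : ψ q + δ ≤ w q := by
    simp only [hw, if_pos (mem_ball_self hr), le_max_right]
  linarith

lemma const_mem_perronFamily {M : ℝ} (hM : 0 ≤ M) (hl : 0 < l) (hupper : ∀ q, H q 0 ≤ M) :
    (fun _ => -M / l) ∈ perronFamily H l K (M / l) := by
  refine ⟨LipschitzWith.const' _, fun y =>
    div_le_div_of_nonneg_right (by linarith) hl.le, fun φ hφ q hq => ?_⟩
  have h0 : gradient φ q = 0 := by
    have := hq.fderiv_eq_zero
    rw [fderiv_const_sub, neg_eq_zero] at this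
    simp [gradient, this]
  rw [h0, mul_div_cancel₀ _ hl.ne']
  linarith [hupper q]

/-- Existence of viscosity solutions of the discounted equation `l u + H(q, du) = 0`, with a
Lipschitz constant which does not depend on the discount `l`. -/
theorem exists_discounted_solution (hH : Continuous fun x : E × E => H x.1 x.2)
    {m M : ℝ} (hm : 0 < m) (hM : 0 ≤ M) (hlower : ∀ q p, m / 2 * ‖p‖ ^ 2 - M ≤ H q p)
    (hupper : ∀ q, H q 0 ≤ M) (hl : 0 < l) (hK : 4 * M ≤ m * K ^ 2) :
    ∃ u : E → ℝ, LipschitzWith K u ∧ (∀ y, |l * u y| ≤ M) ∧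
      (∀ t, (∀ q p, H (q + t) p = H q p) → ∀ q, u (q + t) = u q) ∧
      IsDiscountedSubsolution H l u ∧ IsDiscountedSupersolution H l u := by
  have hmem := const_mem_perronFamily (K := K) hM hl hupper
  have hne : (perronFamily H l K (M / l)).Nonempty := ⟨_, hmem⟩
  have hlow : ∀ y, -M ≤ l * perronSup H l K (M / l) y := fun y => by
    rw [mul_comm, ← div_le_iff₀ hl]
    exact le_perronSup hmem y
  refine ⟨perronSup H l K (M / l), lipschitzWith_perronSup hne, fun y => abs_le.2 ⟨hlow y, ?_⟩,
    fun t ht => perronSup_add_right ht, isDiscountedSubsolution_perronSup hH hl hne,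
    isDiscountedSupersolution_perronSup hH hm hlower hl hK hne hlow⟩
  rw [mul_comm, ← le_div_iff₀ hl]
  exact perronSup_le hne fun v hv => hv.2.1 y

end Perron

lemma Ultrafilter.exists_tendsto_of_abs_le {ι : Type*} (f : Ultrafilter ι) {s : ι → ℝ} {C : ℝ}
    (h : ∀ i, |s i| ≤ C) : ∃ a, Tendsto s f (𝓝 a) := by
  obtain ⟨a, -, ha⟩ := (isCompact_Icc (a := -C) (b := C)).ultrafilter_le_nhds (f.map s)
    (by
      rw [le_principal_iff]
      exact Filter.mem_map.2 (univ_mem' fun i => abs_le.1 (h i)))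
  exact ⟨a, ha⟩

lemma tendstoUniformlyOn_closedBall_of_lipschitzWith {ι : Type*} {F : Filter ι} {K : ℝ≥0}
    {v : ι → E → ℝ} {f : E → ℝ} (hv : ∀ i, LipschitzWith K (v i))
    (h : ∀ x, Tendsto (fun i => v i x) F (𝓝 (f x))) (q : E) (r : ℝ) :
    TendstoUniformlyOn v f F (closedBall q r) := by
  have heq : Equicontinuous v := (LipschitzWith.uniformEquicontinuous v K hv).equicontinuous
  have := (EquicontinuousOn.tendsto_uniformOnFun_iff_pi
    (𝔖 := {s : Set E | IsCompact s}) (fun s hs => hs)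
    (eq_univ_of_forall fun x => ⟨{x}, isCompact_singleton, rfl⟩)
    (fun s _ => heq.equicontinuousOn s) F f).2 (tendsto_pi_nhds.2 h)
  exact UniformOnFun.tendsto_iff_tendstoUniformlyOn.1 this _ (isCompact_closedBall q r)

/-- Vanishing discount: a coercive Hamiltonian `H` has a level `a` at which `H(q, du) = a` has a
Lipschitz viscosity solution with the same periods as `H`. -/
theorem exists_ergodic_solution {H : E → E → ℝ} (hH : Continuous fun x : E × E => H x.1 x.2)
    {m M : ℝ} (hm : 0 < m) (hM : 0 ≤ M) (hlower : ∀ q p, m / 2 * ‖p‖ ^ 2 - M ≤ H q p)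
    (hupper : ∀ q, H q 0 ≤ M) :
    ∃ (a : ℝ) (u : E → ℝ), (∃ K : ℝ≥0, LipschitzWith K u) ∧
      (∀ t, (∀ q p, H (q + t) p = H q p) → ∀ q, u (q + t) = u q) ∧
      (∀ φ : E → ℝ, ContDiff ℝ 1 φ → ∀ q : E,
        IsLocalMax (fun y => u y - φ y) q → H q (gradient φ q) ≤ a) ∧
      (∀ φ : E → ℝ, ContDiff ℝ 1 φ → ∀ q : E,
        IsLocalMin (fun y => u y - φ y) q → a ≤ H q (gradient φ q)) := by
  set K : ℝ≥0 := NNReal.sqrt (Real.toNNReal (4 * M / m)) with hKdef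
  have hK : 4 * M ≤ m * (K : ℝ) ^ 2 := by
    rw [hKdef, ← NNReal.coe_pow, NNReal.sq_sqrt, Real.coe_toNNReal _ (by positivity),
      mul_div_cancel₀ _ hm.ne']
  set l : ℕ → ℝ := fun n => 1 / ((n : ℝ) + 1) with hl
  have hlpos : ∀ n, 0 < l n := fun n => Nat.one_div_pos_of_nat
  choose u hu hub hper hsub hsup using fun n =>
    exists_discounted_solution hH hm hM hlower hupper (hlpos n) hK
  set F : Ultrafilter ℕ := hyperfilter ℕ
  have hFl : Tendsto l F (𝓝 0) :=
    tendsto_one_div_add_atTop_nhds_zero_nat.mono_left Nat.hyperfilter_le_atTop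
  set v : ℕ → E → ℝ := fun n x => u n x - u n 0 with hv
  have hvL : ∀ n, LipschitzWith K (v n) := fun n =>
    LipschitzWith.of_le_add_mul K fun x y => by
      have := (hu n).le_add_mul x y
      simp only [hv]
      linarith
  have hvb : ∀ x n, |v n x| ≤ K * dist x 0 := fun x n => by
    rw [← Real.dist_eq]
    exact (hu n).dist_le_mul x 0
  choose f hf using fun x => F.exists_tendsto_of_abs_le (hvb x)
  obtain ⟨b, hb⟩ := F.exists_tendsto_of_abs_le fun n => hub n 0
  have hunif : ∀ q, ∀ δ > 0, ∀ᶠ n in F, ∀ y ∈ closedBall q 1, |f y - v n y| < δ :=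
    fun q δ hδ => Metric.tendstoUniformlyOn_iff.1
      (tendstoUniformlyOn_closedBall_of_lipschitzWith hvL hf q 1) δ hδ
  have hlu : ∀ q, ∀ η > 0, ∀ᶠ n in F, ∀ y ∈ closedBall q 1, |l n * u n y - b| < η := by
    intro q η hη
    have h1 : Tendsto (fun n => l n * (K * (1 + dist q 0))) F (𝓝 0) := by
      simpa using hFl.mul_const (K * (1 + dist q 0))
    filter_upwards [h1.eventually_lt_const (half_pos hη),
      hb.eventually (Metric.ball_mem_nhds b (half_pos hη))] with n hn hn' y hy
    have h2 : |l n * v n y| ≤ l n * (K * (1 + dist q 0)) := by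
      rw [abs_mul, abs_of_pos (hlpos n)]
      have h3 := dist_triangle y q 0
      have h4 : dist y q ≤ 1 := hy
      have h5 := (hlpos n).le
      refine mul_le_mul_of_nonneg_left ((hvb y n).trans ?_) h5
      gcongr
      linarith
    have h6 : |l n * u n 0 - b| < η / 2 := hn'
    have h7 : l n * u n y - b = l n * v n y + (l n * u n 0 - b) := by
      simp only [hv]
      ring
    rw [h7]
    linarith [abs_add_le (l n * v n y) (l n * u n 0 - b)]
  refine ⟨-b, f, ⟨K, LipschitzWith.of_le_add_mul K fun x y => ?_⟩, fun t ht q => ?_,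
    fun φ hφ q hq => ?_, fun φ hφ q hq => ?_⟩
  · exact le_of_tendsto_of_tendsto' (hf x) ((hf y).add_const _) fun n => (hvL n).le_add_mul x y
  · refine tendsto_nhds_unique (hf (q + t)) ((hf q).congr fun n => ?_)
    simp only [hv, hper n t ht]
  · by_contra! hcon
    obtain ⟨η, hη, hη'⟩ : ∃ η > 0, 2 * η < H q (gradient φ q) + b :=
      ⟨(H q (gradient φ q) + b) / 4, by linarith, by linarith⟩
    obtain ⟨ε, hε, hHε⟩ := exists_forall_abs_sub_lt hH q (gradient φ q) hη
    obtain ⟨δ, hδ, h⟩ := exists_perturbed_test_max hφ hq (lt_min hε one_pos)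
    obtain ⟨n, hn1, hn2⟩ := ((hunif q δ hδ).and (hlu q η hη)).exists
    obtain ⟨y, ψ, hψ, hy, hyq, hg, -⟩ := h (v n) (hvL n).continuous
      (fun y hy => by linarith [(abs_lt.1 (hn1 y hy)).1])
      (by linarith [(abs_lt.1 (hn1 q (mem_closedBall_self zero_le_one))).2])
    have h1 := hsub n (fun z => ψ z + u n 0) (hψ.add contDiff_const) y
      (by simpa only [hv, sub_sub, add_comm (u n 0)] using hy)
    have h2 : gradient (fun z => ψ z + u n 0) y = gradient ψ y := by simp [gradient]
    rw [h2] at h1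
    have h3 := abs_lt.1 (hHε y _ (hyq.trans_le (min_le_left _ _)) (hg.trans_le (min_le_left _ _)))
    have h4 := abs_lt.1 (hn2 y (hyq.trans_le (min_le_right _ _)).le)
    linarith
  · by_contra! hcon
    obtain ⟨η, hη, hη'⟩ : ∃ η > 0, 2 * η < -(H q (gradient φ q) + b) :=
      ⟨-(H q (gradient φ q) + b) / 4, by linarith, by linarith⟩
    obtain ⟨ε, hε, hHε⟩ := exists_forall_abs_sub_lt hH q (gradient φ q) hη
    obtain ⟨δ, hδ, h⟩ := exists_perturbed_test_min hφ hq (lt_min hε one_pos)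
    obtain ⟨n, hn1, hn2⟩ := ((hunif q δ hδ).and (hlu q η hη)).exists
    obtain ⟨y, ψ, hψ, hy, hyq, hg, -⟩ := h (v n) (hvL n).continuous
      (fun y hy => by linarith [(abs_lt.1 (hn1 y hy)).2])
      (by linarith [(abs_lt.1 (hn1 q (mem_closedBall_self zero_le_one))).1])
    have h1 := hsup n (fun z => ψ z + u n 0) (hψ.add contDiff_const) y
      (by simpa only [hv, sub_sub, add_comm (u n 0)] using hy)
    have h2 : gradient (fun z => ψ z + u n 0) y = gradient ψ y := by simp [gradient]
    rw [h2] at h1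
    have h3 := abs_lt.1 (hHε y _ (hyq.trans_le (min_le_left _ _)) (hg.trans_le (min_le_left _ _)))
    have h4 := abs_lt.1 (hn2 y (hyq.trans_le (min_le_right _ _)).le)
    linarith

end

/-- For an autonomous, `ℤᵈ`-periodic Tonelli Hamiltonian, there exist a
level `a` and a `ℤᵈ`-periodic Lipschitz viscosity solution of `H(q, du(q)) = a`. -/
theorem existence_of_periodic_weak_KAM_solution {d : ℕ}
    (H : EuclideanSpace ℝ (Fin d) → EuclideanSpace ℝ (Fin d) → ℝ)
    (hH : ContDiff ℝ 2 (fun x : EuclideanSpace ℝ (Fin d) × EuclideanSpace ℝ (Fin d) =>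
      H x.1 x.2))
    (m M : ℝ) (hm : 0 < m) (hmM : m ≤ M)
    (hd2H : ∀ x : EuclideanSpace ℝ (Fin d) × EuclideanSpace ℝ (Fin d),
      ‖iteratedFDeriv ℝ 2
        (fun y : EuclideanSpace ℝ (Fin d) × EuclideanSpace ℝ (Fin d) => H y.1 y.2) x‖ ≤ M)
    (hconv : ∀ q p v : EuclideanSpace ℝ (Fin d),
      m * ‖v‖ ^ 2 ≤ iteratedFDeriv ℝ 2 (fun p' => H q p') p ![v, v])
    (hlower : ∀ q p : EuclideanSpace ℝ (Fin d), m / 2 * ‖p‖ ^ 2 - M ≤ H q p)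
    (hupper : ∀ q p : EuclideanSpace ℝ (Fin d), H q p ≤ M / 2 * ‖p‖ ^ 2 + M)
    -- Hypothesis 5: periodicity of `H`
    (hper : ∀ (w : Fin d → ℤ) (q p : EuclideanSpace ℝ (Fin d)),
      H (q + (EuclideanSpace.equiv (Fin d) ℝ).symm (fun i => (w i : ℝ))) p = H q p) :
    ∃ (a : ℝ) (u : EuclideanSpace ℝ (Fin d) → ℝ),
      -- `u` is Lipschitz
      (∃ K : ℝ≥0, LipschitzWith K u) ∧
      -- `u` is `ℤᵈ`-periodic
      (∀ (w : Fin d → ℤ) (q : EuclideanSpace ℝ (Fin d)),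
        u (q + (EuclideanSpace.equiv (Fin d) ℝ).symm (fun i => (w i : ℝ))) = u q) ∧
      -- viscosity sub-solution property
      (∀ φ : EuclideanSpace ℝ (Fin d) → ℝ, ContDiff ℝ 1 φ →
        ∀ q : EuclideanSpace ℝ (Fin d),
          IsLocalMax (fun y => u y - φ y) q → H q (gradient φ q) ≤ a) ∧
      -- viscosity super-solution property
      (∀ φ : EuclideanSpace ℝ (Fin d) → ℝ, ContDiff ℝ 1 φ →
        ∀ q : EuclideanSpace ℝ (Fin d),
          IsLocalMin (fun y => u y - φ y) q → a ≤ H q (gradient φ q)) := by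
  have hM : 0 ≤ M := hm.le.trans hmM
  obtain ⟨a, u, hu, hup, hsub, hsup⟩ := exists_ergodic_solution hH.continuous hm hM hlower
    fun q => by simpa using hupper q 0
  exact ⟨a, u, hu, fun w => hup _ (hper w), hsub, hsup⟩
end

section
/- Let H(q,p) : ℝ^d × ℝ^d → ℝ be a C² autonomous Hamiltonian satisfying: ‖d²H‖ ≤ M everywhere; ∂²_{pp} H ≥ m·Id in the sense of quadratic forms everywhere; (m/2)|p|² − M ≤ H(q,p) ≤ (M/2)|p|² + M everywhere, with 0 < m ≤ M; and H(q + w, p) = H(q, p) for every w ∈ ℤ^d. If u and v are ℤ^d-periodic Lipschitz functions which are viscosity solutions of H(q, du(q)) = a and H(q, dv(q)) = b respectively, then a = b. In other words, all periodic weak KAM solutions have the same level, namely the periodic critical value α(0). -/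
open scoped RealInnerProductSpace NNReal
open Set

/-- The gradient of a multiple of the squared distance to a point. -/
theorem gradient_const_mul_norm_sub_sq {E : Type*} [NormedAddCommGroup E]
    [InnerProductSpace ℝ E] [CompleteSpace E] (c : ℝ) (z q : E) :
    gradient (fun y => c * ‖y - z‖ ^ 2) q = (2 * c) • (q - z) := by
  apply HasGradientAt.gradient
  rw [hasGradientAt_iff_hasFDerivAt]
  have h := (((hasFDerivAt_id (𝕜 := ℝ) q).sub_const z).norm_sq).const_mul c
  refine h.congr_fderiv ?_
  ext w
  simp
  ring

/-- Comparison of levels: for a continuous periodic Hamiltonian, if `u` is a periodic continuous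
supersolution at level `a` and `v` a periodic Lipschitz subsolution at level `b`,
then `a ≤ b`. -/
theorem level_le_of_periodic_supersolution_of_subsolution {d : ℕ}
    (H : EuclideanSpace ℝ (Fin d) → EuclideanSpace ℝ (Fin d) → ℝ)
    (hH : Continuous (fun x : EuclideanSpace ℝ (Fin d) × EuclideanSpace ℝ (Fin d) =>
      H x.1 x.2))
    (a b : ℝ) (u v : EuclideanSpace ℝ (Fin d) → ℝ)
    (hu : Continuous u) (K : ℝ≥0) (hv : LipschitzWith K v)
    (hu_per : ∀ (w : Fin d → ℤ) (q : EuclideanSpace ℝ (Fin d)),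
      u (q + (EuclideanSpace.equiv (Fin d) ℝ).symm (fun i => (w i : ℝ))) = u q)
    (hv_per : ∀ (w : Fin d → ℤ) (q : EuclideanSpace ℝ (Fin d)),
      v (q + (EuclideanSpace.equiv (Fin d) ℝ).symm (fun i => (w i : ℝ))) = v q)
    (hu_super : ∀ φ : EuclideanSpace ℝ (Fin d) → ℝ, ContDiff ℝ 1 φ →
      ∀ q : EuclideanSpace ℝ (Fin d),
        IsLocalMin (fun y => u y - φ y) q → a ≤ H q (gradient φ q))
    (hv_sub : ∀ φ : EuclideanSpace ℝ (Fin d) → ℝ, ContDiff ℝ 1 φ →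
      ∀ q : EuclideanSpace ℝ (Fin d),
        IsLocalMax (fun y => v y - φ y) q → H q (gradient φ q) ≤ b) :
    a ≤ b := by
  -- a compact fundamental domain
  obtain ⟨Q, hQc, hQne, hQ⟩ : ∃ Q : Set (EuclideanSpace ℝ (Fin d)), IsCompact Q ∧ Q.Nonempty ∧
      ∀ x : EuclideanSpace ℝ (Fin d), ∃ w : Fin d → ℤ,
        x + (EuclideanSpace.equiv (Fin d) ℝ).symm (fun i => (w i : ℝ)) ∈ Q := by
    refine ⟨(EuclideanSpace.equiv (Fin d) ℝ).symm '' Icc 0 1,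
      isCompact_Icc.image (EuclideanSpace.equiv (Fin d) ℝ).symm.continuous,
      (nonempty_Icc.2 zero_le_one).image _, fun x => ⟨fun i => -⌊x i⌋, ?_⟩⟩
    refine ⟨fun i => Int.fract (x i), ⟨fun i => Int.fract_nonneg _,
      fun i => (Int.fract_lt_one _).le⟩, ?_⟩
    ext i
    simp [Int.fract, sub_eq_add_neg]
  obtain ⟨R, hR⟩ := hQc.isBounded.subset_closedBall (0 : EuclideanSpace ℝ (Fin d))
  refine le_of_forall_pos_le_add fun ε hε => ?_
  -- uniform continuity of the Hamiltonian on the relevant compact set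
  have hcomp : IsCompact (Metric.closedBall (0 : EuclideanSpace ℝ (Fin d)) (R + 1) ×ˢ
      Metric.closedBall (0 : EuclideanSpace ℝ (Fin d)) (2 * K)) :=
    (isCompact_closedBall _ _).prod (isCompact_closedBall _ _)
  obtain ⟨δ, hδ, hHδ⟩ := Metric.uniformContinuousOn_iff.1
    (hcomp.uniformContinuousOn_of_continuous hH.continuousOn) ε hε
  obtain ⟨n, hn0, hn1, hnδ⟩ : ∃ n : ℝ, 0 < n ∧ K < n ∧ K < n * δ := by
    refine ⟨K + 1 + K / δ, by positivity, ?_, ?_⟩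
    · have : 0 ≤ (K : ℝ) / δ := by positivity
      linarith
    · have : (K : ℝ) / δ * δ = K := div_mul_cancel₀ _ hδ.ne'
      nlinarith [K.2, mul_nonneg K.2 hδ.le]
  -- the penalised functional attains its maximum
  obtain ⟨⟨x, z⟩, ⟨hxQ, hz⟩, hmax⟩ :=
    (hQc.prod (isCompact_closedBall (0 : EuclideanSpace ℝ (Fin d)) 1)).exists_isMaxOn
      (hQne.prod ⟨0, by simp⟩)
      (f := fun s : EuclideanSpace ℝ (Fin d) × EuclideanSpace ℝ (Fin d) => v s.1 - u (s.1 + s.2) - n * ‖s.2‖ ^ 2)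
      (by have := hv.continuous; fun_prop)
  have hΦ : ∀ x' y' : EuclideanSpace ℝ (Fin d), ‖x' - y'‖ ≤ 1 →
      v x' - u y' - n * ‖x' - y'‖ ^ 2 ≤ v x - u (x + z) - n * ‖z‖ ^ 2 := by
    intro x' y' h
    obtain ⟨w, hw⟩ := hQ x'
    have key := hmax (Set.mk_mem_prod hw
      (show y' - x' ∈ Metric.closedBall (0 : EuclideanSpace ℝ (Fin d)) 1 by
        rwa [mem_closedBall_zero_iff, norm_sub_rev]))
    have e : x' + (EuclideanSpace.equiv (Fin d) ℝ).symm (fun i => (w i : ℝ)) + (y' - x')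
        = y' + (EuclideanSpace.equiv (Fin d) ℝ).symm (fun i => (w i : ℝ)) := by abel
    simp only [Set.mem_ofPred_eq, e, hu_per, hv_per] at key
    rwa [norm_sub_rev] at key
  obtain ⟨y, rfl⟩ : ∃ y, z = y - x := ⟨x + z, by abel⟩
  simp only [add_sub_cancel, norm_sub_rev y x] at hΦ
  -- the maximum is close to the diagonal
  have hpen : n * ‖x - y‖ ≤ K := by
    have h1 := hΦ y y (by simp)
    have h2 : v x - v y ≤ K * ‖x - y‖ := by
      have := hv.dist_le_mul x y
      rw [dist_eq_norm, dist_eq_norm] at this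
      exact (le_abs_self _).trans this
    simp only [sub_self, norm_zero] at h1
    by_contra! hlt
    have hpos : 0 < ‖x - y‖ := by
      by_contra! h0
      have : (0 : ℝ) ≤ K := K.2
      nlinarith
    nlinarith [mul_lt_mul_of_pos_right hlt hpos]
  have hxy : ‖x - y‖ < 1 := by
    by_contra! h
    nlinarith
  have hxyδ : ‖x - y‖ < δ := by
    by_contra! h
    nlinarith [mul_le_mul_of_nonneg_left h hn0.le]
  have hsmooth : ∀ (c : ℝ) (z : EuclideanSpace ℝ (Fin d)), ContDiff ℝ 1 (fun y => c * ‖y - z‖ ^ 2) := fun c z =>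
    contDiff_const.mul ((contDiff_id.sub contDiff_const).norm_sq ℝ)
  have hb : H x ((2 * n) • (x - y)) ≤ b := by
    have h := hv_sub (fun x' => n * ‖x' - y‖ ^ 2) (hsmooth n y) x ?_
    · rwa [gradient_const_mul_norm_sub_sq] at h
    · have : ∀ᶠ x' in nhds x, ‖x' - y‖ < 1 :=
        (continuous_id.sub continuous_const).norm.continuousAt.eventually_lt
          continuousAt_const hxy
      filter_upwards [this] with x' hx'
      have := hΦ x' y hx'.le
      linarith
  have ha : a ≤ H y ((2 * n) • (x - y)) := by
    have h := hu_super (fun y' => -n * ‖y' - x‖ ^ 2) (hsmooth (-n) x) y ?_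
    · rw [gradient_const_mul_norm_sub_sq] at h
      rwa [show (2 * n) • (x - y) = (2 * -n) • (y - x) by module]
    · have : ∀ᶠ y' in nhds y, ‖x - y'‖ < 1 :=
        (continuous_const.sub continuous_id).norm.continuousAt.eventually_lt
          continuousAt_const hxy
      filter_upwards [this] with y' hy'
      have := hΦ x y' hy'.le
      rw [norm_sub_rev y' x, norm_sub_rev y x]
      linarith
  have hxR : ‖x‖ ≤ R := mem_closedBall_zero_iff.1 (hR hxQ)
  have hyR : ‖y‖ ≤ R + 1 := by
    have := norm_sub_norm_le y x
    rw [norm_sub_rev] at this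
    linarith
  have hp : ‖(2 * n) • (x - y)‖ ≤ 2 * K := by
    rw [norm_smul, Real.norm_of_nonneg (by positivity)]
    linarith
  have hHxy := hHδ (x, (2 * n) • (x - y))
    ⟨mem_closedBall_zero_iff.2 (by simpa using hxR.trans (by linarith)),
      mem_closedBall_zero_iff.2 hp⟩ (y, (2 * n) • (x - y))
    ⟨mem_closedBall_zero_iff.2 hyR, mem_closedBall_zero_iff.2 hp⟩
    (by simpa [Prod.dist_eq, dist_eq_norm] using hxyδ)
  rw [Real.dist_eq, abs_lt] at hHxy
  linarith [hHxy.1]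

/-- For an autonomous, `ℤᵈ`-periodic Tonelli Hamiltonian, if `u` and `v`
are `ℤᵈ`-periodic Lipschitz viscosity solutions of `H(q, du(q)) = a` and `H(q, dv(q)) = b`
respectively, then `a = b`: all periodic weak KAM solutions have the same level. -/
theorem uniqueness_of_level_of_periodic_weak_KAM_solutions {d : ℕ}
    (H : EuclideanSpace ℝ (Fin d) → EuclideanSpace ℝ (Fin d) → ℝ)
    (hH : ContDiff ℝ 2 (fun x : EuclideanSpace ℝ (Fin d) × EuclideanSpace ℝ (Fin d) =>
      H x.1 x.2))
    (m M : ℝ) (hm : 0 < m) (hmM : m ≤ M)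
    (hd2H : ∀ x : EuclideanSpace ℝ (Fin d) × EuclideanSpace ℝ (Fin d),
      ‖iteratedFDeriv ℝ 2
        (fun y : EuclideanSpace ℝ (Fin d) × EuclideanSpace ℝ (Fin d) => H y.1 y.2) x‖ ≤ M)
    (hconv : ∀ q p v : EuclideanSpace ℝ (Fin d),
      m * ‖v‖ ^ 2 ≤ iteratedFDeriv ℝ 2 (fun p' => H q p') p ![v, v])
    (hlower : ∀ q p : EuclideanSpace ℝ (Fin d), m / 2 * ‖p‖ ^ 2 - M ≤ H q p)
    (hupper : ∀ q p : EuclideanSpace ℝ (Fin d), H q p ≤ M / 2 * ‖p‖ ^ 2 + M)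
    -- Hypothesis 5: periodicity of `H`
    (hper : ∀ (w : Fin d → ℤ) (q p : EuclideanSpace ℝ (Fin d)),
      H (q + (EuclideanSpace.equiv (Fin d) ℝ).symm (fun i => (w i : ℝ))) p = H q p)
    (a b : ℝ) (u v : EuclideanSpace ℝ (Fin d) → ℝ)
    -- `u` and `v` are Lipschitz and `ℤᵈ`-periodic
    (hu_lip : ∃ K : ℝ≥0, LipschitzWith K u)
    (hv_lip : ∃ K : ℝ≥0, LipschitzWith K v)
    (hu_per : ∀ (w : Fin d → ℤ) (q : EuclideanSpace ℝ (Fin d)),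
      u (q + (EuclideanSpace.equiv (Fin d) ℝ).symm (fun i => (w i : ℝ))) = u q)
    (hv_per : ∀ (w : Fin d → ℤ) (q : EuclideanSpace ℝ (Fin d)),
      v (q + (EuclideanSpace.equiv (Fin d) ℝ).symm (fun i => (w i : ℝ))) = v q)
    -- `u` is a viscosity solution of `H(q, du(q)) = a`
    (hu_sub : ∀ φ : EuclideanSpace ℝ (Fin d) → ℝ, ContDiff ℝ 1 φ →
      ∀ q : EuclideanSpace ℝ (Fin d),
        IsLocalMax (fun y => u y - φ y) q → H q (gradient φ q) ≤ a)
    (hu_super : ∀ φ : EuclideanSpace ℝ (Fin d) → ℝ, ContDiff ℝ 1 φ →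
      ∀ q : EuclideanSpace ℝ (Fin d),
        IsLocalMin (fun y => u y - φ y) q → a ≤ H q (gradient φ q))
    -- `v` is a viscosity solution of `H(q, dv(q)) = b`
    (hv_sub : ∀ φ : EuclideanSpace ℝ (Fin d) → ℝ, ContDiff ℝ 1 φ →
      ∀ q : EuclideanSpace ℝ (Fin d),
        IsLocalMax (fun y => v y - φ y) q → H q (gradient φ q) ≤ b)
    (hv_super : ∀ φ : EuclideanSpace ℝ (Fin d) → ℝ, ContDiff ℝ 1 φ →
      ∀ q : EuclideanSpace ℝ (Fin d),
        IsLocalMin (fun y => v y - φ y) q → b ≤ H q (gradient φ q)) :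
    a = b := by
  obtain ⟨K, hu⟩ := hu_lip
  obtain ⟨L, hv⟩ := hv_lip
  exact le_antisymm
    (level_le_of_periodic_supersolution_of_subsolution H hH.continuous a b u v hu.continuous L hv
      hu_per hv_per hu_super hv_sub)
    (level_le_of_periodic_supersolution_of_subsolution H hH.continuous b a v u hv.continuous K hu
      hv_per hu_per hv_super hu_sub)
end

section
/- Let u : ℝ^d → ℝ be a function and K > 0. Let ℐ ⊂ ℝ^d be the set of points q for which there exist linear forms l⁺ and l⁻ on ℝ^d such that u(q + θ) ≤ u(q) + l⁺(θ) + K‖θ‖² and u(q + θ) ≥ u(q) + l⁻(θ) − K‖θ‖² for all θ ∈ ℝ^d. Then u is differentiable at each point of ℐ, and the map q ↦ du(q) is 6K-Lipschitz on ℐ, i.e. ‖du(q + y) − du(q)‖ ≤ 6K‖y‖ whenever q and q + y both belong to ℐ. -/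
open Set

section NormedSpace

variable {E : Type*} [NormedAddCommGroup E] [NormedSpace ℝ E]

/-- A linear form bounded above by a multiple of `‖θ‖ ^ 2` vanishes. -/
theorem eq_zero_of_forall_le_mul_norm_sq {L : E →L[ℝ] ℝ} {C : ℝ} (hC : 0 ≤ C)
    (h : ∀ θ, L θ ≤ C * ‖θ‖ ^ 2) : L = 0 := by
  have nonpos : ∀ θ, L θ ≤ 0 := by
    intro θ
    by_contra! hpos
    have hB : 0 ≤ C * ‖θ‖ ^ 2 := by positivity
    set t := L θ / (C * ‖θ‖ ^ 2 + 1) with ht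
    have htpos : 0 < t := by positivity
    have hLt : L θ = t * (C * ‖θ‖ ^ 2 + 1) := by rw [ht]; field_simp
    have hscaled := h (t • θ)
    rw [map_smul, smul_eq_mul, norm_smul, mul_pow, Real.norm_eq_abs, sq_abs, hLt] at hscaled
    nlinarith [mul_pos htpos htpos]
  ext θ
  refine le_antisymm (nonpos θ) ?_
  have := nonpos (-θ)
  rw [map_neg] at this
  simpa using this

/-- Super- and sub-differentials at a common point coincide. -/
theorem superdifferential_eq_subdifferential {u : E → ℝ} {q : E} {K : ℝ} (hK : 0 ≤ K)
    {lsup lsub : E →L[ℝ] ℝ} (hsup : ∀ θ, u (q + θ) ≤ u q + lsup θ + K * ‖θ‖ ^ 2)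
    (hsub : ∀ θ, u q + lsub θ - K * ‖θ‖ ^ 2 ≤ u (q + θ)) : lsup = lsub := by
  refine (sub_eq_zero.mp (eq_zero_of_forall_le_mul_norm_sq (C := 2 * K) (by positivity)
    fun θ ↦ ?_)).symm
  rw [sub_apply]
  linarith [hsup θ, hsub θ]

theorem hasFDerivAt_of_abs_sub_le_mul_norm_sq {u : E → ℝ} {q : E} {K : ℝ} {l : E →L[ℝ] ℝ}
    (h : ∀ θ, |u (q + θ) - u q - l θ| ≤ K * ‖θ‖ ^ 2) : HasFDerivAt u l q := by
  rw [hasFDerivAt_iff_isLittleO_nhds_zero]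
  refine (Asymptotics.IsBigO.of_bound K (.of_forall fun θ ↦ ?_)).trans_isLittleO
    (Asymptotics.isLittleO_norm_pow_id one_lt_two)
  simpa using h θ

/-- A function with a `K`-super-differential and a `K`-sub-differential at `q` has a derivative
there, which approximates it up to `K * ‖θ‖ ^ 2`. -/
theorem exists_hasFDerivAt_abs_sub_le {u : E → ℝ} {q : E} {K : ℝ} (hK : 0 ≤ K)
    (h : (∃ lsup : E →L[ℝ] ℝ, ∀ θ, u (q + θ) ≤ u q + lsup θ + K * ‖θ‖ ^ 2) ∧
      (∃ lsub : E →L[ℝ] ℝ, ∀ θ, u q + lsub θ - K * ‖θ‖ ^ 2 ≤ u (q + θ))) :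
    ∃ l : E →L[ℝ] ℝ, HasFDerivAt u l q ∧
      ∀ θ, |u (q + θ) - u q - l θ| ≤ K * ‖θ‖ ^ 2 := by
  obtain ⟨⟨lsup, hsup⟩, lsub, hsub⟩ := h
  obtain rfl := superdifferential_eq_subdifferential hK hsup hsub
  have happrox : ∀ θ, |u (q + θ) - u q - lsup θ| ≤ K * ‖θ‖ ^ 2 := fun θ ↦
    abs_le.mpr ⟨by linarith [hsub θ], by linarith [hsup θ]⟩
  exact ⟨lsup, hasFDerivAt_of_abs_sub_le_mul_norm_sq happrox, happrox⟩

theorem norm_sub_le_of_abs_sub_le_mul_norm_sq {u : E → ℝ} {q y : E} {K : ℝ} (hK : 0 ≤ K)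
    {l m : E →L[ℝ] ℝ} (hy : y ≠ 0)
    (hl : ∀ θ, |u (q + θ) - u q - l θ| ≤ K * ‖θ‖ ^ 2)
    (hm : ∀ θ, |u (q + y + θ) - u (q + y) - m θ| ≤ K * ‖θ‖ ^ 2) :
    ‖m - l‖ ≤ 6 * K * ‖y‖ := by
  have hypos : 0 < ‖y‖ := norm_pos_iff.mpr hy
  have upper : ∀ θ, ‖θ‖ = ‖y‖ → (m - l) θ ≤ 6 * K * ‖y‖ ^ 2 := by
    intro θ hθ
    have hyθ := (abs_le.mp (hl (y + θ))).2
    have hly := (abs_le.mp (hl y)).1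
    have hmθ := (abs_le.mp (hm θ)).1
    rw [map_add, ← add_assoc] at hyθ
    have hnorm : ‖y + θ‖ ^ 2 ≤ (2 * ‖y‖) ^ 2 := by
      gcongr
      linarith [norm_add_le y θ]
    have := mul_le_mul_of_nonneg_left hnorm hK
    rw [hθ] at hmθ
    rw [sub_apply]
    linarith
  refine ContinuousLinearMap.opNorm_le_of_unit_norm (by positivity) fun x hx ↦ ?_
  have hscale : ‖‖y‖ • x‖ = ‖y‖ := by rw [norm_smul, norm_norm, hx, mul_one]
  have hpos := upper (‖y‖ • x) hscale
  have hneg := upper (-(‖y‖ • x)) (by rw [norm_neg, hscale])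
  rw [map_neg] at hneg
  rw [map_smul, smul_eq_mul] at hpos hneg
  rw [Real.norm_eq_abs, abs_le]
  constructor <;> refine le_of_mul_le_mul_left ?_ hypos <;> linarith

end NormedSpace

/-- **Fathi.** If `ℐ` is the set of points where `u` admits both a
`K`-super-differential and a `K`-sub-differential, then `u` is differentiable on `ℐ` and
`q ↦ du(q)` is `6K`-Lipschitz on `ℐ`. -/
theorem C11_regularity_on_sub_super_differentiability_set {d : ℕ}
    (u : EuclideanSpace ℝ (Fin d) → ℝ) (K : ℝ) (hK : 0 < K) :
    (∀ q : EuclideanSpace ℝ (Fin d),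
      ((∃ lsup : EuclideanSpace ℝ (Fin d) →L[ℝ] ℝ,
          ∀ θ, u (q + θ) ≤ u q + lsup θ + K * ‖θ‖ ^ 2) ∧
        (∃ lsub : EuclideanSpace ℝ (Fin d) →L[ℝ] ℝ,
          ∀ θ, u q + lsub θ - K * ‖θ‖ ^ 2 ≤ u (q + θ))) →
      DifferentiableAt ℝ u q) ∧
    (∀ q y : EuclideanSpace ℝ (Fin d),
      ((∃ lsup : EuclideanSpace ℝ (Fin d) →L[ℝ] ℝ,
          ∀ θ, u (q + θ) ≤ u q + lsup θ + K * ‖θ‖ ^ 2) ∧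
        (∃ lsub : EuclideanSpace ℝ (Fin d) →L[ℝ] ℝ,
          ∀ θ, u q + lsub θ - K * ‖θ‖ ^ 2 ≤ u (q + θ))) →
      ((∃ lsup : EuclideanSpace ℝ (Fin d) →L[ℝ] ℝ,
          ∀ θ, u (q + y + θ) ≤ u (q + y) + lsup θ + K * ‖θ‖ ^ 2) ∧
        (∃ lsub : EuclideanSpace ℝ (Fin d) →L[ℝ] ℝ,
          ∀ θ, u (q + y) + lsub θ - K * ‖θ‖ ^ 2 ≤ u (q + y + θ))) →
      ‖fderiv ℝ u (q + y) - fderiv ℝ u q‖ ≤ 6 * K * ‖y‖) := by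
  refine ⟨fun q hq ↦ ?_, fun q y hq hqy ↦ ?_⟩
  · obtain ⟨l, hl, -⟩ := exists_hasFDerivAt_abs_sub_le hK.le hq
    exact hl.differentiableAt
  · rcases eq_or_ne y 0 with rfl | hy
    · simp
    obtain ⟨l, hl, hl_approx⟩ := exists_hasFDerivAt_abs_sub_le hK.le hq
    obtain ⟨m, hm, hm_approx⟩ := exists_hasFDerivAt_abs_sub_le hK.le hqy
    rw [hm.fderiv, hl.fderiv]
    exact norm_sub_le_of_abs_sub_le_mul_norm_sq hK.le hy hl_approx hm_approx
end
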